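/- arXiv:math/0408062 — 3 statements merged into one kernel-verified Lean document; each statement's English description precedes it below -/
import Mathlib

section
/- Let P₁₃ ∈ ℂ[X,Y] be weighted-homogeneous of degree 13 for the weights deg(X,Y) = (1,2), and assume the polynomial Y⁷ + X·P₁₃ is squarefree. Let P̃₉ ∈ ℂ[x,y,z,w] be weighted-homogeneous of degree 9 for the weights deg(x,y,z,w) = (1,2,3,4) and satisfy P̃₉(X², X²Y, X²Y², X²Y³) = X⁵·P₁₃(X,Y) in ℂ[X,Y]. Let A = ℂ[X,Y,T]/(T² − Y⁷ − X·P₁₃) and let φ : ℂ[x,y,z,w,v,u] → A be the ℂ-algebra homomorphism with φ(x)=X², φ(y)=X²Y, φ(z)=X²Y², φ(w)=X²Y³, φ(v)=X³T, φ(u)=X³YT. Then the kernel of φ equals the ideal I generated by the six 2×2 minors of [[x,y,z,v],[y,z,w,u]] together with v²−z²w−xP̃₉, vu−zw²−yP̃₉, u²−w³−zP̃₉; equivalently, ker φ is the ideal of the fifteen 4×4 Pfaffians of the antisymmetric matrix M with upper-triangular entries M₁₂=0, M₁₃=z, M₁₄=v, M₁₅=y, M₁₆=x, M₂₃=w, M₂₄=u,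 M₂₅=z, M₂₆=y, M₃₄=P̃₉, M₃₅=u, M₃₆=v, M₄₅=w², M₄₆=zw, M₅₆=0. -/
open Matrix MvPolynomial

/-- The 4×4 Pfaffian `Pf_{ijkl}(N) = N_{ij}N_{kl} − N_{ik}N_{jl} + N_{il}N_{jk}`
of a 6×6 antisymmetric matrix. -/
def pf {R : Type*} [CommRing R] (N : Matrix (Fin 6) (Fin 6) R) (i j k l : Fin 6) : R :=
  N i j * N k l - N i k * N j l + N i l * N j k

/-- The set of the fifteen 4×4 Pfaffians of a 6×6 antisymmetric matrix. -/
def pfaffians {R : Type*} [CommRing R] (N : Matrix (Fin 6) (Fin 6) R) : Set R :=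
  { x | ∃ i j k l : Fin 6, i < j ∧ j < k ∧ k < l ∧ x = pf N i j k l }

/-- The principal ideal `(T² − Y⁷ − X·P₁₃)` in `ℂ[X,Y,T]` (variables `X 0 = X`,
`X 1 = Y`, `X 2 = T`). -/
noncomputable def relIdeal (P13 : MvPolynomial (Fin 2) ℂ) : Ideal (MvPolynomial (Fin 3) ℂ) :=
  Ideal.span {(X 2 : MvPolynomial (Fin 3) ℂ) ^ 2 - (X 1) ^ 7 -
    X 0 * rename (Fin.castLE (by norm_num)) P13}

/-- The ℂ-algebra homomorphism `φ : ℂ[x,y,z,w,v,u] → A = ℂ[X,Y,T]/(T² − Y⁷ − X·P₁₃)` with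
`φ(x)=X², φ(y)=X²Y, φ(z)=X²Y², φ(w)=X²Y³, φ(v)=X³T, φ(u)=X³YT`. -/
noncomputable def phi (P13 : MvPolynomial (Fin 2) ℂ) :
    MvPolynomial (Fin 6) ℂ →ₐ[ℂ] (MvPolynomial (Fin 3) ℂ ⧸ relIdeal P13) :=
  aeval fun i => Ideal.Quotient.mk (relIdeal P13)
    (![(X 0 : MvPolynomial (Fin 3) ℂ) ^ 2, (X 0) ^ 2 * X 1, (X 0) ^ 2 * (X 1) ^ 2,
      (X 0) ^ 2 * (X 1) ^ 3, (X 0) ^ 3 * X 2, (X 0) ^ 3 * X 1 * X 2] i)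

/-- The monomials `xᵃ·{1,y,z}·wᵈ·{1,v}` and `wᵈ·u`, evaluated at a point `g` of a ring. -/
def normalMonomial {B : Type*} [CommRing B] (g : Fin 6 → B) :
    (Fin 2 × ℕ × Fin 3 × ℕ) ⊕ ℕ → B
  | .inl (b, a, r, d) => g 4 ^ (b : ℕ) * (g 0 ^ a * ![1, g 1, g 2] r * g 3 ^ d)
  | .inr d => g 5 * g 3 ^ d

section Spanning

variable {K B : Type*} [Field K] [CommRing B] [Algebra K B] {g : Fin 6 → B}

theorem mul_mem_span_of_forall {ι : Type*} {n : ι → B} {c : B}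
    (h : ∀ i, ∃ j, c * n i = n j) {b : B} (hb : b ∈ Submodule.span K (Set.range n)) :
    c * b ∈ Submodule.span K (Set.range n) := by
  induction hb using Submodule.span_induction with
  | mem b hb =>
    obtain ⟨i, rfl⟩ := hb
    obtain ⟨j, hj⟩ := h i
    exact hj ▸ Submodule.subset_span ⟨j, rfl⟩
  | zero => simp
  | add b b' _ _ hb hb' => exact mul_add c b b' ▸ add_mem hb hb'
  | smul t b _ hb => exact mul_smul_comm t c b ▸ Submodule.smul_mem _ t hb

theorem mul_mem_of_mem_adjoin {s : Set B} {W : Submodule K B}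
    (h : ∀ c ∈ s, ∀ b ∈ W, c * b ∈ W) {c : B} (hc : c ∈ Algebra.adjoin K s) :
    ∀ b ∈ W, c * b ∈ W := by
  induction hc using Algebra.adjoin_induction with
  | mem c hc => exact h c hc
  | algebraMap t => exact fun b hb => Algebra.smul_def t b ▸ W.smul_mem t hb
  | add c c' _ _ hc hc' => exact fun b hb => add_mul c c' b ▸ add_mem (hc b hb) (hc' b hb)
  | mul c c' _ _ hc hc' => exact fun b hb => mul_assoc c c' b ▸ hc _ (hc' b hb)

/-- The normal monomials span any algebra generated by six elements satisfying the relations of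
the curve ideal. -/
theorem span_normalMonomial_eq_top (hg : Algebra.adjoin K (Set.range g) = ⊤) {q : B}
    (hq : q ∈ Algebra.adjoin K {g 0, g 1, g 2, g 3})
    (hxz : g 0 * g 2 = g 1 ^ 2) (hxw : g 0 * g 3 = g 1 * g 2) (hxu : g 0 * g 5 = g 1 * g 4)
    (hyw : g 1 * g 3 = g 2 ^ 2) (hyu : g 1 * g 5 = g 2 * g 4) (hzu : g 2 * g 5 = g 3 * g 4)
    (hvv : g 4 ^ 2 = g 2 ^ 2 * g 3 + g 0 * q) (hvu : g 4 * g 5 = g 2 * g 3 ^ 2 + g 1 * q)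
    (huu : g 5 ^ 2 = g 3 ^ 3 + g 2 * q) :
    Submodule.span K (Set.range (normalMonomial g)) = ⊤ := by
  set W := Submodule.span K (Set.range (normalMonomial g))
  have mem (i) : normalMonomial g i ∈ W := Submodule.subset_span ⟨i, rfl⟩
  have hx : ∀ b ∈ W, g 0 * b ∈ W := fun b => by
    refine mul_mem_span_of_forall ?_
    rintro (⟨b, a, r, d⟩ | d)
    · exact ⟨.inl (b, a + 1, r, d), by simp only [normalMonomial]; ring⟩
    · exact ⟨.inl (1, 0, 1, d), by
        simp [normalMonomial]; linear_combination g 3 ^ d * hxu⟩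
  have hy : ∀ b ∈ W, g 1 * b ∈ W := fun b => by
    refine mul_mem_span_of_forall ?_
    rintro (⟨b, a, r, d⟩ | d)
    · fin_cases r
      · exact ⟨.inl (b, a, 1, d), by simp [normalMonomial]; ring⟩
      · exact ⟨.inl (b, a + 1, 2, d), by
          simp [normalMonomial]; linear_combination -g 4 ^ (b : ℕ) * g 0 ^ a * g 3 ^ d * hxz⟩
      · exact ⟨.inl (b, a + 1, 0, d + 1), by
          simp [normalMonomial]; linear_combination -g 4 ^ (b : ℕ) * g 0 ^ a * g 3 ^ d * hxw⟩
    · exact ⟨.inl (1, 0, 2, d), by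
        simp [normalMonomial]; linear_combination g 3 ^ d * hyu⟩
  have hz : ∀ b ∈ W, g 2 * b ∈ W := fun b => by
    refine mul_mem_span_of_forall ?_
    rintro (⟨b, a, r, d⟩ | d)
    · fin_cases r
      · exact ⟨.inl (b, a, 2, d), by simp [normalMonomial]; ring⟩
      · exact ⟨.inl (b, a + 1, 0, d + 1), by
          simp [normalMonomial]; linear_combination -g 4 ^ (b : ℕ) * g 0 ^ a * g 3 ^ d * hxw⟩
      · exact ⟨.inl (b, a, 1, d + 1), by
          simp [normalMonomial]; linear_combination -g 4 ^ (b : ℕ) * g 0 ^ a * g 3 ^ d * hyw⟩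
    · exact ⟨.inl (1, 0, 0, d + 1), by
        simp [normalMonomial]; linear_combination g 3 ^ d * hzu⟩
  have hw : ∀ b ∈ W, g 3 * b ∈ W := fun b => by
    refine mul_mem_span_of_forall ?_
    rintro (⟨b, a, r, d⟩ | d)
    · exact ⟨.inl (b, a, r, d + 1), by simp only [normalMonomial]; ring⟩
    · exact ⟨.inr (d + 1), by simp only [normalMonomial]; ring⟩
  have one_mem : (1 : B) ∈ W := by simpa [normalMonomial] using mem (.inl (0, 0, 0, 0))
  have hadj : ∀ c ∈ Algebra.adjoin K {g 0, g 1, g 2, g 3}, ∀ b ∈ W, c * b ∈ W := fun c hc => by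
    refine mul_mem_of_mem_adjoin ?_ hc
    rintro c (rfl | rfl | rfl | rfl)
    exacts [hx, hy, hz, hw]
  have hvmem : g 4 ∈ W := by simpa [normalMonomial] using mem (.inl (1, 0, 0, 0))
  have humem : g 5 ∈ W := by simpa [normalMonomial] using mem (.inr 0)
  have hg0 : g 0 ∈ Algebra.adjoin K {g 0, g 1, g 2, g 3} := Algebra.subset_adjoin (by simp)
  have hg1 : g 1 ∈ Algebra.adjoin K {g 0, g 1, g 2, g 3} := Algebra.subset_adjoin (by simp)
  have hg2 : g 2 ∈ Algebra.adjoin K {g 0, g 1, g 2, g 3} := Algebra.subset_adjoin (by simp)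
  have hg3 : g 3 ∈ Algebra.adjoin K {g 0, g 1, g 2, g 3} := Algebra.subset_adjoin (by simp)
  have hvv_mem : g 4 * g 4 ∈ W := by
    rw [← pow_two, hvv, ← mul_one (_ + _)]
    exact hadj _ (add_mem (mul_mem (pow_mem hg2 2) hg3) (mul_mem hg0 hq)) _ one_mem
  have hvu_mem : g 4 * g 5 ∈ W := by
    rw [hvu, ← mul_one (_ + _)]
    exact hadj _ (add_mem (mul_mem hg2 (pow_mem hg3 2)) (mul_mem hg1 hq)) _ one_mem
  have huu_mem : g 5 * g 5 ∈ W := by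
    rw [← pow_two, huu, ← mul_one (_ + _)]
    exact hadj _ (add_mem (pow_mem hg3 3) (mul_mem hg2 hq)) _ one_mem
  have hcoeff (a : ℕ) (r : Fin 3) (d : ℕ) :
      g 0 ^ a * ![1, g 1, g 2] r * g 3 ^ d ∈ Algebra.adjoin K {g 0, g 1, g 2, g 3} := by
    refine mul_mem (mul_mem (pow_mem hg0 a) ?_) (pow_mem hg3 d)
    fin_cases r
    exacts [(Algebra.adjoin K _).one_mem, hg1, hg2]
  have mul_mem_of {c : B} (hc : c ∈ W) (hcv : c * g 4 ∈ W) (hcu : c * g 5 ∈ W) :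
      ∀ b ∈ W, c * b ∈ W := fun b hb => by
    induction hb using Submodule.span_induction with
    | mem b hb =>
      obtain ⟨⟨b, a, r, d⟩ | d, rfl⟩ := hb
      · fin_cases b
        · convert hadj _ (hcoeff a r d) _ hc using 1
          simp only [normalMonomial]
          ring
        · convert hadj _ (hcoeff a r d) _ hcv using 1
          simp only [normalMonomial]
          ring
      · convert hadj _ (pow_mem hg3 d) _ hcu using 1
        simp only [normalMonomial]
        ring
    | zero => simp
    | add b b' _ _ hb hb' => exact mul_add c b b' ▸ add_mem hb hb'
    | smul t b _ hb => exact mul_smul_comm t c b ▸ Submodule.smul_mem _ t hb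
  refine eq_top_iff.2 fun b _ => ?_
  rw [← mul_one b]
  refine mul_mem_of_mem_adjoin (K := K) (s := Set.range g) ?_ (hg ▸ Algebra.mem_top) 1 one_mem
  rintro _ ⟨i, rfl⟩
  fin_cases i
  exacts [hx, hy, hz, hw, mul_mem_of hvmem hvv_mem hvu_mem,
    mul_mem_of humem (mul_comm (g 4) (g 5) ▸ hvu_mem) huu_mem]

end Spanning

/-- The polynomials in `X, Y, T` lifting the images of the six variables under `phi`. -/
noncomputable def phiLift : Fin 6 → MvPolynomial (Fin 3) ℂ :=
  ![X 0 ^ 2, X 0 ^ 2 * X 1, X 0 ^ 2 * X 1 ^ 2, X 0 ^ 2 * X 1 ^ 3, X 0 ^ 3 * X 2,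
    X 0 ^ 3 * X 1 * X 2]

theorem phi_apply (P13 : MvPolynomial (Fin 2) ℂ) (p : MvPolynomial (Fin 6) ℂ) :
    phi P13 p = Ideal.Quotient.mk (relIdeal P13) (aeval phiLift p) := by
  have : phi P13 = (Ideal.Quotient.mkₐ ℂ (relIdeal P13)).comp (aeval phiLift) := by
    ext i
    simp [phi, phiLift]
  rw [this]
  rfl

/-- The exponent vector of `normalMonomial phiLift i`. -/
noncomputable def normalExponent : (Fin 2 × ℕ × Fin 3 × ℕ) ⊕ ℕ → (Fin 3 →₀ ℕ)
  | .inl (b, a, r, d) =>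
    .single 0 (3 * b + 2 * (a + ![0, 1, 1] r + d)) + .single 1 (r + 3 * d) + .single 2 b
  | .inr d => .single 0 (3 + 2 * d) + .single 1 (1 + 3 * d) + .single 2 1

theorem map_normalMonomial {B C : Type*} [CommRing B] [CommRing C] (f : B →+* C)
    (g : Fin 6 → B) (i : (Fin 2 × ℕ × Fin 3 × ℕ) ⊕ ℕ) :
    f (normalMonomial g i) = normalMonomial (f ∘ g) i := by
  obtain ⟨b, a, r, d⟩ | d := i
  · fin_cases r <;> simp [normalMonomial]
  · simp [normalMonomial]

theorem normalMonomial_phiLift (i : (Fin 2 × ℕ × Fin 3 × ℕ) ⊕ ℕ) :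
    normalMonomial phiLift i = monomial (normalExponent i) 1 := by
  have key (a b c : ℕ) : (monomial (.single 0 a + .single 1 b + .single 2 c) 1 :
      MvPolynomial (Fin 3) ℂ) = X 0 ^ a * X 1 ^ b * X 2 ^ c := by
    simp [X_pow_eq_monomial, monomial_mul]
  obtain ⟨b, a, r, d⟩ | d := i
  · simp only [normalExponent, key]
    fin_cases r <;> simp [normalMonomial, phiLift] <;> ring
  · simp only [normalExponent, key]
    simp [normalMonomial, phiLift]
    ring

theorem normalExponent_injective : Function.Injective normalExponent := by
  intro i j h
  have h0 := DFunLike.congr_fun h 0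
  have h1 := DFunLike.congr_fun h 1
  have h2 := DFunLike.congr_fun h 2
  obtain ⟨b, a, r, d⟩ | d := i <;> obtain ⟨b', a', r', d'⟩ | d' := j
  · fin_cases r <;> fin_cases r' <;> simp [normalExponent] at h0 h1 h2 ⊢ <;> omega
  · fin_cases r <;> simp [normalExponent] at h0 h1 h2 <;> omega
  · fin_cases r' <;> simp [normalExponent] at h0 h1 h2 <;> omega
  · simp [normalExponent] at h1 ⊢
    omega

theorem normalExponent_apply_two_le (i : (Fin 2 × ℕ × Fin 3 × ℕ) ⊕ ℕ) :
    normalExponent i 2 ≤ 1 := by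
  obtain ⟨b, a, r, d⟩ | d := i
  · simp [normalExponent]
    omega
  · simp [normalExponent]

/-- A nonzero element of `relIdeal` has degree at least two in `T`. -/
theorem eq_zero_of_mem_relIdeal {P13 : MvPolynomial (Fin 2) ℂ} {f : MvPolynomial (Fin 3) ℂ}
    (hf : f ∈ relIdeal P13) (hdeg : degreeOf 2 f ≤ 1) : f = 0 := by
  obtain ⟨h, rfl⟩ := Ideal.mem_span_singleton'.1 hf
  by_contra hne
  obtain ⟨hh, hr⟩ := mul_ne_zero_iff.1 hne
  rw [degreeOf_mul_eq hh hr] at hdeg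
  set r := (X 2 : MvPolynomial (Fin 3) ℂ) ^ 2 - X 1 ^ 7 -
    X 0 * rename (Fin.castLE (by norm_num)) P13 with hr_def
  have hcoeff : coeff (.single 2 2) r = 1 := by
    simp [hr_def, X_pow_eq_monomial, coeff_X_mul', Finsupp.single_eq_single_iff]
  have := monomial_le_degreeOf (f := r) 2 (m := .single 2 2) (by simp [mem_support_iff, hcoeff])
  simp at this
  omega

theorem eq_zero_of_phi_linearCombination_eq_zero {P13 : MvPolynomial (Fin 2) ℂ}
    {c : (Fin 2 × ℕ × Fin 3 × ℕ) ⊕ ℕ →₀ ℂ}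
    (hc : phi P13 (Finsupp.linearCombination ℂ (normalMonomial X) c) = 0) : c = 0 := by
  have hmap (i) : aeval phiLift (normalMonomial X i : MvPolynomial (Fin 6) ℂ) =
      (monomial (normalExponent i) 1 : MvPolynomial (Fin 3) ℂ) := by
    rw [← normalMonomial_phiLift]
    refine (map_normalMonomial (aeval phiLift : _ →ₐ[ℂ] MvPolynomial (Fin 3) ℂ).toRingHom
      X i).trans (congrArg (normalMonomial · i) ?_)
    exact _root_.funext fun j => aeval_X phiLift j
  have hlift : aeval phiLift
      (Finsupp.linearCombination ℂ (normalMonomial (X : _ → MvPolynomial (Fin 6) ℂ)) c) =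
      c.sum fun i t => (monomial (normalExponent i) t : MvPolynomial (Fin 3) ℂ) := by
    simp only [Finsupp.linearCombination_apply, map_finsuppSum, map_smul, hmap, smul_monomial,
      smul_eq_mul, mul_one]
  rw [phi_apply, Ideal.Quotient.eq_zero_iff_mem, hlift] at hc
  have hzero := eq_zero_of_mem_relIdeal hc <| (degreeOf_sum_le _ _ _).trans <|
    Finset.sup_le fun i hi => (degreeOf_monomial_eq _ _ (Finsupp.mem_support_iff.1 hi)).trans_le
      (normalExponent_apply_two_le i)
  ext i
  have hcoeff := congrArg (coeff (normalExponent i)) hzero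
  simpa [Finsupp.sum, coeff_sum, coeff_monomial, normalExponent_injective.eq_iff] using hcoeff

theorem aeval_phiLift_rename {P13 : MvPolynomial (Fin 2) ℂ} {Q : MvPolynomial (Fin 4) ℂ}
    (hQ : aeval ![(X 0 : MvPolynomial (Fin 2) ℂ) ^ 2, (X 0) ^ 2 * X 1,
        (X 0) ^ 2 * (X 1) ^ 2, (X 0) ^ 2 * (X 1) ^ 3] Q = (X 0) ^ 5 * P13) :
    aeval phiLift (rename (Fin.castLE (by norm_num) : Fin 4 → Fin 6) Q) =
      X 0 ^ 5 * rename (Fin.castLE (by norm_num) : Fin 2 → Fin 3) P13 := by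
  have := congrArg (rename (Fin.castLE (by norm_num) : Fin 2 → Fin 3)) hQ
  rw [map_mul, map_pow, rename_X] at this
  refine Eq.trans ?_ this
  rw [aeval_rename, ← AlgHom.comp_apply]
  congr 1
  ext i
  fin_cases i <;> simp [phiLift]

theorem span_pfaffians_eq {R : Type*} [CommRing R] (x y z w v u q : R) :
    Ideal.span (pfaffians !![0, 0, z, v, y, x;
        0, 0, w, u, z, y;
        -z, -w, 0, q, u, v;
        -v, -u, -q, 0, w ^ 2, z * w;
        -y, -z, -u, -w ^ 2, 0, 0;
        -x, -y, -v, -(z * w), 0, 0]) =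
      Ideal.span {x * z - y ^ 2, x * w - y * z, x * u - y * v, y * w - z ^ 2, y * u - z * v,
        z * u - w * v, v ^ 2 - z ^ 2 * w - x * q, v * u - z * w ^ 2 - y * q,
        u ^ 2 - w ^ 3 - z * q} := by
  set N : Matrix (Fin 6) (Fin 6) R := !![0, 0, z, v, y, x;
    0, 0, w, u, z, y;
    -z, -w, 0, q, u, v;
    -v, -u, -q, 0, w ^ 2, z * w;
    -y, -z, -u, -w ^ 2, 0, 0;
    -x, -y, -v, -(z * w), 0, 0] with hN
  apply le_antisymm
  · set J := Ideal.span {x * z - y ^ 2, x * w - y * z, x * u - y * v, y * w - z ^ 2, y * u - z * v,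
      z * u - w * v, v ^ 2 - z ^ 2 * w - x * q, v * u - z * w ^ 2 - y * q,
      u ^ 2 - w ^ 3 - z * q}
    rw [Ideal.span_le]
    rintro _ ⟨i, j, k, l, hij, hjk, hkl, rfl⟩
    have hcases : ∀ i j k l : Fin 6, i < j → j < k → k < l → (i, j, k, l) ∈
        [((0 : Fin 6), (1 : Fin 6), (2 : Fin 6), (3 : Fin 6)), (0, 1, 2, 4), (0, 1, 2, 5),
          (0, 1, 3, 4), (0, 1, 3, 5), (0, 1, 4, 5), (0, 2, 3, 4), (0, 2, 3, 5), (0, 2, 4, 5),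
          (0, 3, 4, 5), (1, 2, 3, 4), (1, 2, 3, 5), (1, 2, 4, 5), (1, 3, 4, 5),
          (2, 3, 4, 5)] := by decide
    have h := hcases i j k l hij hjk hkl
    have mem {p : R} (a : R) {r : R} (hr : r ∈ ({x * z - y ^ 2, x * w - y * z, x * u - y * v,
        y * w - z ^ 2, y * u - z * v, z * u - w * v, v ^ 2 - z ^ 2 * w - x * q,
        v * u - z * w ^ 2 - y * q, u ^ 2 - w ^ 3 - z * q} : Set R)) (hp : p = a * r) : p ∈ J :=
      hp ▸ J.mul_mem_left a (Ideal.subset_span hr)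
    simp only [List.mem_cons, Prod.mk.injEq, List.not_mem_nil, or_false] at h
    obtain h | h | h | h | h | h | h | h | h | h | h | h | h | h | h := h <;>
      obtain ⟨rfl, rfl, rfl, rfl⟩ := h
    · exact mem (-1) (r := z * u - w * v) (by simp) (by simp [pf, hN]; ring)
    · exact mem 1 (r := y * w - z ^ 2) (by simp) (by simp [pf, hN]; ring)
    · exact mem 1 (r := x * w - y * z) (by simp) (by simp [pf, hN]; ring)
    · exact mem 1 (r := y * u - z * v) (by simp) (by simp [pf, hN]; ring)
    · exact mem 1 (r := x * u - y * v) (by simp) (by simp [pf, hN]; ring)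
    · exact mem 1 (r := x * z - y ^ 2) (by simp) (by simp [pf, hN]; ring)
    · exact mem (-1) (r := v * u - z * w ^ 2 - y * q) (by simp) (by simp [pf, hN]; ring)
    · exact mem (-1) (r := v ^ 2 - z ^ 2 * w - x * q) (by simp) (by simp [pf, hN]; ring)
    · exact mem 1 (r := x * u - y * v) (by simp) (by simp [pf, hN]; ring)
    · exact mem w (r := x * w - y * z) (by simp) (by simp [pf, hN]; ring)
    · exact mem (-1) (r := u ^ 2 - w ^ 3 - z * q) (by simp) (by simp [pf, hN]; ring)
    · exact mem (-1) (r := v * u - z * w ^ 2 - y * q) (by simp) (by simp [pf, hN]; ring)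
    · exact mem 1 (r := y * u - z * v) (by simp) (by simp [pf, hN]; ring)
    · exact mem w (r := y * w - z ^ 2) (by simp) (by simp [pf, hN]; ring)
    · exact mem (-w) (r := z * u - w * v) (by simp) (by simp [pf, hN]; ring)
  · have mem {p : R} (a : R) (i j k l : Fin 6) (h : i < j ∧ j < k ∧ k < l)
        (hp : p = a * pf N i j k l) : p ∈ Ideal.span (pfaffians N) :=
      hp ▸ Ideal.mul_mem_left _ a (Ideal.subset_span ⟨i, j, k, l, h.1, h.2.1, h.2.2, rfl⟩)
    rw [Ideal.span_le]
    rintro _ (rfl | rfl | rfl | rfl | rfl | rfl | rfl | rfl | rfl)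
    · exact mem 1 0 1 4 5 (by decide) (by simp [pf, hN]; ring)
    · exact mem 1 0 1 2 5 (by decide) (by simp [pf, hN]; ring)
    · exact mem 1 0 1 3 5 (by decide) (by simp [pf, hN]; ring)
    · exact mem 1 0 1 2 4 (by decide) (by simp [pf, hN]; ring)
    · exact mem 1 0 1 3 4 (by decide) (by simp [pf, hN]; ring)
    · exact mem (-1) 0 1 2 3 (by decide) (by simp [pf, hN]; ring)
    · exact mem (-1) 0 2 3 5 (by decide) (by simp [pf, hN]; ring)
    · exact mem (-1) 0 2 3 4 (by decide) (by simp [pf, hN]; ring)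
    · exact mem (-1) 1 2 3 4 (by decide) (by simp [pf, hN]; ring)

/-- Let `P₁₃ ∈ ℂ[X,Y]` be weighted-homogeneous of degree 13 for weights `(1,2)` with
`Y⁷ + X·P₁₃` squarefree, and let `P̃₉ = Q ∈ ℂ[x,y,z,w]` be weighted-homogeneous of degree 9
for weights `(1,2,3,4)` with `Q(X², X²Y, X²Y², X²Y³) = X⁵·P₁₃`.  Then the kernel of the map
`φ : ℂ[x,y,z,w,v,u] → ℂ[X,Y,T]/(T²−Y⁷−X·P₁₃)` equals the ideal `I` generated by the six
2×2 minors of `[[x,y,z,v],[y,z,w,u]]` together with `v²−z²w−xQ`, `vu−zw²−yQ`, `u²−w³−zQ`,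
which in turn equals the ideal of the fifteen 4×4 Pfaffians of the matrix `M`. -/
theorem ker_phi_eq_pfaffian_ideal
    (P13 : MvPolynomial (Fin 2) ℂ)
    (hP13 : P13.IsWeightedHomogeneous ![1, 2] 13)
    (hsf : Squarefree ((X 1 : MvPolynomial (Fin 2) ℂ) ^ 7 + X 0 * P13))
    (Q : MvPolynomial (Fin 4) ℂ)
    (hQhom : Q.IsWeightedHomogeneous ![1, 2, 3, 4] 9)
    (hQ : aeval ![(X 0 : MvPolynomial (Fin 2) ℂ) ^ 2, (X 0) ^ 2 * X 1,
        (X 0) ^ 2 * (X 1) ^ 2, (X 0) ^ 2 * (X 1) ^ 3] Q = (X 0) ^ 5 * P13)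
    (Q' : MvPolynomial (Fin 6) ℂ) (hQ' : Q' = rename (Fin.castLE (by norm_num)) Q)
    (I : Ideal (MvPolynomial (Fin 6) ℂ))
    (hI : I = Ideal.span ({X 0 * X 2 - (X 1)^2, X 0 * X 3 - X 1 * X 2, X 0 * X 5 - X 1 * X 4,
        X 1 * X 3 - (X 2)^2, X 1 * X 5 - X 2 * X 4, X 2 * X 5 - X 3 * X 4,
        (X 4)^2 - (X 2)^2 * X 3 - X 0 * Q',
        X 4 * X 5 - X 2 * (X 3)^2 - X 1 * Q',
        (X 5)^2 - (X 3)^3 - X 2 * Q'} : Set (MvPolynomial (Fin 6) ℂ)))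
    (M : Matrix (Fin 6) (Fin 6) (MvPolynomial (Fin 6) ℂ))
    (hM : M = !![0, 0, X 2, X 4, X 1, X 0;
                 0, 0, X 3, X 5, X 2, X 1;
                 -X 2, -X 3, 0, Q', X 5, X 4;
                 -X 4, -X 5, -Q', 0, (X 3)^2, X 2 * X 3;
                 -X 1, -X 2, -X 5, -(X 3)^2, 0, 0;
                 -X 0, -X 1, -X 4, -(X 2 * X 3), 0, 0]) :
    RingHom.ker (phi P13).toRingHom = I ∧ I = Ideal.span (pfaffians M) := by
  have hker : I ≤ RingHom.ker (phi P13).toRingHom := by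
    rw [hI, Ideal.span_le]
    have hrel (c : MvPolynomial (Fin 3) ℂ) := Ideal.mul_mem_left (relIdeal P13) c
      (Ideal.mem_span_singleton_self _)
    have mem {p c} (h : aeval phiLift p = c * ((X 2 : MvPolynomial (Fin 3) ℂ) ^ 2 - (X 1) ^ 7 -
        X 0 * rename (Fin.castLE (by norm_num)) P13)) : p ∈ RingHom.ker (phi P13).toRingHom :=
      (phi_apply P13 p).trans (Ideal.Quotient.eq_zero_iff_mem.2 (h ▸ hrel c))
    have hlift := hQ' ▸ aeval_phiLift_rename hQ
    rintro _ (rfl | rfl | rfl | rfl | rfl | rfl | rfl | rfl | rfl)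
    iterate 6 exact mem (c := 0) (by simp [phiLift]; ring)
    · exact mem (c := X 0 ^ 6) (by
        simp only [map_sub, map_mul, map_pow, aeval_X, hlift]; simp [phiLift]; ring)
    · exact mem (c := X 0 ^ 6 * X 1) (by
        simp only [map_sub, map_mul, map_pow, aeval_X, hlift]; simp [phiLift]; ring)
    · exact mem (c := X 0 ^ 6 * X 1 ^ 2) (by
        simp only [map_sub, map_mul, map_pow, aeval_X, hlift]; simp [phiLift]; ring)
  refine ⟨le_antisymm (fun p hp => ?_) hker, ?_⟩
  · have hspan : Submodule.span ℂ
        (Set.range (normalMonomial fun i => Ideal.Quotient.mk I (X i))) = ⊤ := by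
      have rel {a b : MvPolynomial (Fin 6) ℂ} (h : a - b ∈ I) :
          Ideal.Quotient.mk I a = Ideal.Quotient.mk I b := Ideal.Quotient.eq.2 h
      have hadj : Algebra.adjoin ℂ (Set.range fun i => Ideal.Quotient.mk I (X i)) = ⊤ := by
        have := congrArg (Subalgebra.map (Ideal.Quotient.mkₐ ℂ I)) (adjoin_range_X (σ := Fin 6))
        rw [AlgHom.map_adjoin, ← Set.range_comp, Algebra.map_top,
          (AlgHom.range_eq_top _).2 (Ideal.Quotient.mkₐ_surjective ℂ I)] at this
        exact this
      refine span_normalMonomial_eq_top hadj (q := Ideal.Quotient.mk I Q') ?_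
        (rel ?_) (rel ?_) (rel ?_) (rel ?_) (rel ?_) (rel ?_) (rel ?_) (rel ?_) (rel ?_)
      · have hset : ({Ideal.Quotient.mk I (X 0), Ideal.Quotient.mk I (X 1),
            Ideal.Quotient.mk I (X 2), Ideal.Quotient.mk I (X 3)} : Set _) =
            Set.range fun i : Fin 4 => Ideal.Quotient.mkₐ ℂ I (X (Fin.castLE (by norm_num) i)) := by
          ext b
          simp [Fin.exists_fin_succ, eq_comm]
        rw [hset, Algebra.adjoin_range_eq_range_aeval, hQ']
        exact ⟨Q, AlgHom.congr_fun (show aeval _ = (Ideal.Quotient.mkₐ ℂ I).comp (rename _) by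
          ext i
          simp) Q⟩
      all_goals
        rw [hI]
        refine Ideal.subset_span ?_
        simp [sub_sub]
    obtain ⟨c, hc⟩ := (Finsupp.mem_span_range_iff_exists_finsupp).1
      (hspan ▸ Submodule.mem_top (x := Ideal.Quotient.mk I p))
    have hpc : p - Finsupp.linearCombination ℂ (normalMonomial X) c ∈ I := by
      rw [← Ideal.Quotient.eq, ← hc, Finsupp.linearCombination_apply, map_finsuppSum]
      refine Finset.sum_congr rfl fun i _ => ?_
      exact congrArg (c i • ·) (map_normalMonomial (Ideal.Quotient.mk I) X i).symm
    have hc0 : c = 0 := eq_zero_of_phi_linearCombination_eq_zero (P13 := P13) <| by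
      have h := hker hpc
      have h' := sub_mem hp h
      rwa [sub_sub_cancel] at h'
    simpa [hc0] using hpc
  · rw [hI, hM, span_pfaffians_eq]
end

section
/- Let P₁₃ ∈ ℂ[X,Y] be weighted-homogeneous of degree 13 for the weights deg(X,Y) = (1,2), and assume Y⁷ + X·P₁₃ is squarefree. Let P̃₉ ∈ ℂ[x,y,z,w] be weighted-homogeneous of degree 9 for the weights deg(x,y,z,w) = (1,2,3,4) with P̃₉(X², X²Y, X²Y², X²Y³) = X⁵·P₁₃(X,Y), and let I ⊆ ℂ[x,y,z,w,v,u] be the ideal generated by the six 2×2 minors of [[x,y,z,v],[y,z,w,u]] together with v²−z²w−xP̃₉, vu−zw²−yP̃₉, u²−w³−zP̃₉. Then the quotient ring ℂ[x,y,z,w,v,u]/I is an integral domain of Krull dimension 2. -/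
open MvPolynomial

theorem ringKrullDim_eq_of_isIntegral_of_injective {R S : Type*} [CommRing R] [CommRing S]
    [Algebra R S] [Algebra.IsIntegral R S] (h : Function.Injective (algebraMap R S)) :
    ringKrullDim S = ringKrullDim R := by
  apply le_antisymm
  · exact Order.krullDim_le_of_strictMono (PrimeSpectrum.comap (algebraMap R S))
      fun P Q hPQ => Ideal.IsIntegral.comap_lt_comap hPQ
  · have : FaithfulSMul R S := (faithfulSMul_iff_algebraMap_injective R S).mpr h
    refine iSup_le fun l => ?_
    obtain ⟨P, hP, hPl⟩ :=
      (inferInstance : Nonempty ((RelSeries.head l).asIdeal.primesOver S))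
    obtain ⟨L, hL, -⟩ := Ideal.exists_ltSeries_of_hasGoingUp l P
    exact hL ▸ Order.LTSeries.length_le_krullDim L

/-- Every element of a domain has a square root in some field containing the domain. -/
theorem exists_field_sqrt.{u, v} (k : Type u) {R : Type v} [CommRing k] [CommRing R] [IsDomain R]
    [Algebra k R] (F : R) :
    ∃ (L : Type v) (_ : Field L) (_ : Algebra k L) (_ : Algebra R L) (_ : IsScalarTower k R L),
      Function.Injective (algebraMap R L) ∧ ∃ t : L, t ^ 2 = algebraMap R L F := by
  refine ⟨AlgebraicClosure (FractionRing R), inferInstance, inferInstance, inferInstance,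
    inferInstance, ?_, IsAlgClosed.exists_pow_nat_eq _ two_pos⟩
  rw [IsScalarTower.algebraMap_eq R (FractionRing R)]
  exact (algebraMap (FractionRing R) _).injective.comp (IsFractionRing.injective _ _)

namespace Polynomial

/-- Polynomials whose exponents lie in distinct residue classes modulo `3` are independent. -/
theorem eq_zero_of_add_expand_three_eq_zero {R : Type*} [CommRing R] [IsDomain R]
    {b₀ b₁ b₂ : R} (h₀ : b₀ ≠ 0) (h₁ : b₁ ≠ 0) (h₂ : b₂ ≠ 0) {g₀ g₁ g₂ : R[X]}
    (h : C b₀ * expand R 3 g₀ + C b₁ * (expand R 3 g₁ * X) + C b₂ * (expand R 3 g₂ * X ^ 2) = 0) :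
    g₀ = 0 ∧ g₁ = 0 ∧ g₂ = 0 := by
  have key (n : ℕ) := congrArg (fun p => p.coeff n) h
  simp only [coeff_add, coeff_C_mul, coeff_zero, coeff_mul_X_pow', coeff_expand three_pos] at key
  refine ⟨ext fun n => ?_, ext fun n => ?_, ext fun n => ?_⟩
  · have := key (3 * n)
    rcases n with _ | n
    · simpa [h₀] using this
    · rw [show 3 * (n + 1) = (3 * n + 2) + 1 by ring, coeff_mul_X, coeff_expand three_pos,
        if_neg (by omega : ¬ 3 ∣ 3 * n + 2), if_neg (by omega : ¬ 3 ∣ 3 * n + 2 + 1 - 2),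
        if_pos (by omega : 3 ∣ 3 * n + 2 + 1),
        show (3 * n + 2 + 1) / 3 = n + 1 by omega] at this
      simpa [h₀] using this
  · have := key (3 * n + 1)
    rw [coeff_mul_X, coeff_expand three_pos, if_neg (by omega : ¬ 3 ∣ 3 * n + 1),
      if_pos (by omega : 3 ∣ 3 * n), show 3 * n / 3 = n by omega] at this
    have h3 : (if 2 ≤ 3 * n + 1 then
        (if 3 ∣ 3 * n + 1 - 2 then g₂.coeff ((3 * n + 1 - 2) / 3) else 0) else 0) = 0 := by
      split_ifs <;> first | rfl | omega
    rw [h3] at this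
    simpa [h₁] using this
  · have := key (3 * n + 2)
    rw [coeff_mul_X, coeff_expand three_pos, if_neg (by omega : ¬ 3 ∣ 3 * n + 2),
      if_neg (by omega : ¬ 3 ∣ 3 * n + 1), if_pos (by omega : 2 ≤ 3 * n + 2),
      if_pos (by omega : 3 ∣ 3 * n + 2 - 2), show (3 * n + 2 - 2) / 3 = n by omega] at this
    simpa [h₂] using this

/-- A square root of a polynomial of odd degree is linearly independent from `1`. -/
theorem eq_zero_of_add_mul_sqrt_eq_zero {R L : Type*} [CommRing R] [IsDomain R] [CommRing L]
    {j : R[X] →+* L} (hj : Function.Injective j) {F : R[X]} (hF : Odd F.natDegree) {t : L}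
    (ht : t ^ 2 = j F) {p q : R[X]} (h : j p + j q * t = 0) : p = 0 ∧ q = 0 := by
  have hF0 : F ≠ 0 := by rintro rfl; simp at hF
  have hpq : p ^ 2 = q ^ 2 * F := hj <| by
    simp only [map_pow, map_mul]
    rw [← ht]
    linear_combination (j p - j q * t) * h
  have hq : q = 0 := by
    by_contra hq
    have hdeg := congrArg natDegree hpq
    rw [natDegree_mul (pow_ne_zero 2 hq) hF0, natDegree_pow, natDegree_pow] at hdeg
    obtain ⟨k, hk⟩ := hF
    omega
  subst hq
  exact ⟨by simpa using hpq, rfl⟩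

end Polynomial

section Spanning

variable {k S A : Type*} [CommRing k] [CommRing S] [CommRing A] [Algebra k A] [Algebra S A]

/-- The algebra defined by the `2 × 2` minors of `[[x,y,z,v],[y,z,w,u]]` and the three relations
for `v²`, `vu`, `u²` is spanned by `1, y, z, v, u, zv` over the subring generated by `x, w`. -/
theorem span_eq_top_of_minors (hC : ∀ c : k, ∃ s : S, algebraMap S A s = algebraMap k A c)
    {g : Fin 6 → A} (hg : Function.Surjective (aeval g : MvPolynomial (Fin 6) k →ₐ[k] A))
    {sx sw : S} (hx : algebraMap S A sx = g 0) (hw : algebraMap S A sw = g 3)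
    {Q : MvPolynomial (Fin 4) k} {q : A}
    (hq : aeval (fun i => g (Fin.castLE (by norm_num) i)) Q = q)
    (h₁ : g 0 * g 2 = g 1 ^ 2) (h₂ : g 0 * g 3 = g 1 * g 2) (h₃ : g 0 * g 5 = g 1 * g 4)
    (h₄ : g 1 * g 3 = g 2 ^ 2) (h₅ : g 1 * g 5 = g 2 * g 4) (h₆ : g 2 * g 5 = g 3 * g 4)
    (h₇ : g 4 ^ 2 = g 2 ^ 2 * g 3 + g 0 * q) (h₈ : g 4 * g 5 = g 2 * g 3 ^ 2 + g 1 * q)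
    (h₉ : g 5 ^ 2 = g 3 ^ 3 + g 2 * q) :
    Submodule.span S {1, g 1, g 2, g 4, g 5, g 2 * g 4} = ⊤ := by
  set N := Submodule.span S {1, g 1, g 2, g 4, g 5, g 2 * g 4} with hN
  have mul_mem_of {a : A} (h : a ∈ N ∧ g 1 * a ∈ N ∧ g 2 * a ∈ N ∧ g 4 * a ∈ N ∧ g 5 * a ∈ N ∧
      (g 2 * g 4) * a ∈ N) : ∀ m ∈ N, m * a ∈ N := fun m hm => by
    induction hm using Submodule.span_induction with
    | mem m hm =>
      simp only [Set.mem_insert_iff, Set.mem_singleton_iff] at hm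
      rcases hm with rfl | rfl | rfl | rfl | rfl | rfl <;> simp [h]
    | zero => simp
    | add m n _ _ hm hn => rw [add_mul]; exact N.add_mem hm hn
    | smul s m _ hm => rw [smul_mul_assoc]; exact N.smul_mem s hm
  have scal (s : S) (m : A) (hm : m ∈ N) : m * algebraMap S A s ∈ N := by
    rw [mul_comm, ← Algebra.smul_def]; exact N.smul_mem s hm
  have m0 (m : A) (hm : m ∈ N) : m * g 0 ∈ N := hx ▸ scal sx m hm
  have m3 (m : A) (hm : m ∈ N) : m * g 3 ∈ N := hw ▸ scal sw m hm
  have e0 : (1 : A) ∈ N := Submodule.subset_span (by simp)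
  have e1 : g 1 ∈ N := Submodule.subset_span (by simp)
  have e2 : g 2 ∈ N := Submodule.subset_span (by simp)
  have e4 : g 4 ∈ N := Submodule.subset_span (by simp)
  have e5 : g 5 ∈ N := Submodule.subset_span (by simp)
  have e6 : g 2 * g 4 ∈ N := Submodule.subset_span (by simp)
  have e12 : g 1 * g 2 ∈ N := by rw [← h₂, ← one_mul (g 0)]; exact m3 _ (m0 _ e0)
  have m1 : ∀ m ∈ N, m * g 1 ∈ N := mul_mem_of
    ⟨e1, by rw [← sq, ← h₁, mul_comm]; exact m0 _ e2, by rwa [mul_comm],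
      by rw [mul_comm, ← h₃, mul_comm]; exact m0 _ e5, by rwa [mul_comm, h₅],
      by rw [show g 2 * g 4 * g 1 = g 4 * g 3 * g 0 by linear_combination -g 4 * h₂]
         exact m0 _ (m3 _ e4)⟩
  have m2 : ∀ m ∈ N, m * g 2 ∈ N := mul_mem_of
    ⟨e2, e12, by rw [← sq, ← h₄]; exact m3 _ e1, by rwa [mul_comm],
      by rw [mul_comm, h₆, mul_comm]; exact m3 _ e4,
      by rw [show g 2 * g 4 * g 2 = g 5 * g 0 * g 3 by
           linear_combination -g 4 * h₄ - g 3 * h₃]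
         exact m3 _ (m0 _ e5)⟩
  have memC (c : k) (m : A) (hm : m ∈ N) : m * algebraMap k A c ∈ N := by
    obtain ⟨s, hs⟩ := hC c
    exact hs ▸ scal s m hm
  have mq : q ∈ N := by
    rw [← hq]
    clear hq
    induction Q using MvPolynomial.induction_on with
    | C c => simpa using memC c 1 e0
    | add p p' hp hp' => rw [map_add]; exact N.add_mem hp hp'
    | mul_X p i hp =>
      rw [map_mul, aeval_X]
      fin_cases i
      exacts [m0 _ hp, m1 _ hp, m2 _ hp, m3 _ hp]
  have e44 : g 4 * g 4 ∈ N := by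
    rw [← sq, h₇]
    exact N.add_mem (m3 _ (by rw [sq]; exact m2 _ e2)) (by rw [mul_comm]; exact m0 _ mq)
  have e45 : g 4 * g 5 ∈ N := by
    rw [h₈, sq, ← mul_assoc]
    exact N.add_mem (m3 _ (m3 _ e2)) (by rw [mul_comm]; exact m1 _ mq)
  have e55 : g 5 * g 5 ∈ N := by
    rw [← sq, h₉]
    exact N.add_mem (by simpa [pow_succ] using m3 _ (m3 _ (m3 _ e0)))
      (by rw [mul_comm]; exact m2 _ mq)
  have m4 : ∀ m ∈ N, m * g 4 ∈ N := mul_mem_of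
    ⟨e4, by rw [mul_comm]; exact m1 _ e4, e6, e44, by rwa [mul_comm],
      by rw [mul_assoc, mul_comm]; exact m2 _ e44⟩
  have m5 : ∀ m ∈ N, m * g 5 ∈ N := mul_mem_of
    ⟨e5, by rw [mul_comm]; exact m1 _ e5, by rw [mul_comm]; exact m2 _ e5, e45, e55,
      by rw [mul_assoc, mul_comm]; exact m2 _ e45⟩
  refine (Submodule.eq_top_iff').mpr fun a => ?_
  obtain ⟨p, rfl⟩ := hg a
  induction p using MvPolynomial.induction_on with
  | C c => simpa using memC c 1 e0
  | add p p' hp hp' => rw [map_add]; exact N.add_mem hp hp'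
  | mul_X p i hp =>
    rw [map_mul, aeval_X]
    fin_cases i
    exacts [m0 _ hp, m1 _ hp, m2 _ hp, m3 _ hp, m4 _ hp, m5 _ hp]

end Spanning

/-- The image of a weighted-homogeneous polynomial of degree `9` in `x, y, z, w` under
`(x, y, z, w) ↦ (a³, a²Y, aY², Y³)` has degree less than `7` in `Y`. -/
theorem natDegree_aeval_lt_seven {k : Type*} [CommRing k] {Q : MvPolynomial (Fin 4) k}
    (hQ : Q.IsWeightedHomogeneous ![1, 2, 3, 4] 9) (a : Polynomial k) :
    (aeval ![Polynomial.C (a ^ 3), Polynomial.C (a ^ 2) * Polynomial.X,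
      Polynomial.C a * Polynomial.X ^ 2, Polynomial.X ^ 3] Q).natDegree < 7 := by
  rw [aeval_def, eval₂_eq', Nat.lt_succ_iff]
  refine Polynomial.natDegree_sum_le_of_forall_le _ _ fun d hd => ?_
  have hd' := hQ (mem_support_iff.mp hd)
  rw [Finsupp.weight_apply, Finsupp.sum_fintype _ _ (by simp), Fin.sum_univ_four] at hd'
  simp only [smul_eq_mul, Matrix.cons_val] at hd'
  simp only [Fin.prod_univ_four, Matrix.cons_val]
  rw [IsScalarTower.algebraMap_apply k (Polynomial k) (Polynomial (Polynomial k)),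
    Polynomial.algebraMap_eq (R := Polynomial k)]
  compute_degree
  omega

/-- The ring map `k[x][w] → k[a][Y]` with `x ↦ a³` and `w ↦ Y³`. -/
noncomputable def expandThree (k : Type*) [CommRing k] :
    Polynomial (Polynomial k) →+* Polynomial (Polynomial k) :=
  (Polynomial.expand (Polynomial k) 3).toRingHom.comp
    (Polynomial.mapRingHom (Polynomial.expand k 3).toRingHom)

theorem expandThree_eq_zero_of_add {k : Type*} [CommRing k] [IsDomain k] {b₀ b₁ b₂ : Polynomial k}
    (h₀ : b₀ ≠ 0) (h₁ : b₁ ≠ 0) (h₂ : b₂ ≠ 0) {s₀ s₁ s₂ : Polynomial (Polynomial k)}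
    (h : Polynomial.C b₀ * expandThree k s₀ + Polynomial.C b₁ * (expandThree k s₁ * Polynomial.X) +
      Polynomial.C b₂ * (expandThree k s₂ * Polynomial.X ^ 2) = 0) :
    s₀ = 0 ∧ s₁ = 0 ∧ s₂ = 0 := by
  have inj := Polynomial.map_injective (Polynomial.expand k 3).toRingHom
    (Polynomial.expand_injective three_pos)
  obtain ⟨e₀, e₁, e₂⟩ := Polynomial.eq_zero_of_add_expand_three_eq_zero h₀ h₁ h₂ h
  exact ⟨(map_eq_zero_iff (Polynomial.mapRingHom _) inj).mp e₀,
    (map_eq_zero_iff (Polynomial.mapRingHom _) inj).mp e₁,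
    (map_eq_zero_iff (Polynomial.mapRingHom _) inj).mp e₂⟩

/-- Let `P₁₃ ∈ ℂ[X,Y]` be weighted-homogeneous of degree 13 for weights `(1,2)` with
`Y⁷ + X·P₁₃` squarefree, let `P̃₉ = Q ∈ ℂ[x,y,z,w]` be weighted-homogeneous of degree 9
for weights `(1,2,3,4)` with `Q(X², X²Y, X²Y², X²Y³) = X⁵·P₁₃`, and let
`I ⊆ ℂ[x,y,z,w,v,u]` be the ideal generated by the six 2×2 minors of
`[[x,y,z,v],[y,z,w,u]]` together with `v²−z²w−xQ`, `vu−zw²−yQ`, `u²−w³−zQ`.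
Then `ℂ[x,y,z,w,v,u]/I` is an integral domain of Krull dimension 2. -/
theorem quotient_isDomain_krullDim_two
    (P13 : MvPolynomial (Fin 2) ℂ)
    (hP13 : P13.IsWeightedHomogeneous ![1, 2] 13)
    (hsf : Squarefree ((X 1 : MvPolynomial (Fin 2) ℂ) ^ 7 + X 0 * P13))
    (Q : MvPolynomial (Fin 4) ℂ)
    (hQhom : Q.IsWeightedHomogeneous ![1, 2, 3, 4] 9)
    (hQ : aeval ![(X 0 : MvPolynomial (Fin 2) ℂ) ^ 2, (X 0) ^ 2 * X 1,
        (X 0) ^ 2 * (X 1) ^ 2, (X 0) ^ 2 * (X 1) ^ 3] Q = (X 0) ^ 5 * P13)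
    (Q' : MvPolynomial (Fin 6) ℂ) (hQ' : Q' = rename (Fin.castLE (by norm_num)) Q)
    (I : Ideal (MvPolynomial (Fin 6) ℂ))
    (hI : I = Ideal.span ({X 0 * X 2 - (X 1)^2, X 0 * X 3 - X 1 * X 2, X 0 * X 5 - X 1 * X 4,
        X 1 * X 3 - (X 2)^2, X 1 * X 5 - X 2 * X 4, X 2 * X 5 - X 3 * X 4,
        (X 4)^2 - (X 2)^2 * X 3 - X 0 * Q',
        X 4 * X 5 - X 2 * (X 3)^2 - X 1 * Q',
        (X 5)^2 - (X 3)^3 - X 2 * Q'} : Set (MvPolynomial (Fin 6) ℂ))) :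
    IsDomain (MvPolynomial (Fin 6) ℂ ⧸ I) ∧
      ringKrullDim (MvPolynomial (Fin 6) ℂ ⧸ I) = 2 := by
  let a : Polynomial (Polynomial ℂ) := Polynomial.C Polynomial.X
  let Y : Polynomial (Polynomial ℂ) := Polynomial.X
  let q : Polynomial (Polynomial ℂ) :=
    aeval ![Polynomial.C (Polynomial.X ^ 3), Polynomial.C (Polynomial.X ^ 2) * Y,
      a * Y ^ 2, Y ^ 3] Q
  let F : Polynomial (Polynomial ℂ) := Y ^ 7 + a * q
  have hF : F.natDegree = 7 := by
    have hq : (a * q).natDegree < 7 :=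
      (Polynomial.natDegree_C_mul_le _ _).trans_lt (natDegree_aeval_lt_seven hQhom Polynomial.X)
    rw [Polynomial.natDegree_add_eq_left_of_natDegree_lt (by simpa [Y] using hq)]
    simp [Y]
  obtain ⟨L, _, _, _, _, hj, t, ht⟩ := exists_field_sqrt ℂ F
  set j := algebraMap (Polynomial (Polynomial ℂ)) L with hjdef
  let φ : MvPolynomial (Fin 6) ℂ →ₐ[ℂ] L :=
    aeval ![j a ^ 3, j a ^ 2 * j Y, j a * j Y ^ 2, j Y ^ 3, j a * t, j Y * t]
  have hφQ : φ Q' = j q := by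
    rw [hQ', aeval_rename, hjdef, ← aeval_algebraMap_apply]
    congr 2
    funext i
    fin_cases i <;> simp [a, ← hjdef]
  have ht' : t ^ 2 = j Y ^ 7 + j a * j q := by rw [ht]; simp [F]
  have hIφ : ∀ p ∈ I, φ p = 0 := by
    suffices I ≤ RingHom.ker φ from this
    rw [hI, Ideal.span_le]
    intro p hp
    simp only [Set.mem_insert_iff, Set.mem_singleton_iff] at hp
    rw [SetLike.mem_coe, RingHom.mem_ker]
    rcases hp with rfl | rfl | rfl | rfl | rfl | rfl | rfl | rfl | rfl <;>
      simp only [map_sub, map_mul, map_pow, hφQ] <;> simp only [φ, aeval_X, Matrix.cons_val]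
    iterate 6 ring
    · linear_combination j a ^ 2 * ht'
    · linear_combination j a * j Y * ht'
    · linear_combination j Y ^ 2 * ht'
  let g : Fin 6 → MvPolynomial (Fin 6) ℂ ⧸ I := fun i => Ideal.Quotient.mk I (X i)
  have hgmk (p : MvPolynomial (Fin 6) ℂ) : aeval g p = Ideal.Quotient.mk I p := by
    have : (aeval g : _ →ₐ[ℂ] (MvPolynomial (Fin 6) ℂ ⧸ I)) = Ideal.Quotient.mkₐ ℂ I := by
      ext i; simp only [aeval_X]; rfl
    rw [this]; rfl
  let Φ : (MvPolynomial (Fin 6) ℂ ⧸ I) →+* L := Ideal.Quotient.lift I φ.toRingHom hIφ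
  let σ : Polynomial (Polynomial ℂ) →+* MvPolynomial (Fin 6) ℂ ⧸ I :=
    Polynomial.eval₂RingHom (Polynomial.aeval (g 0)).toRingHom (g 3)
  let : Algebra (Polynomial (Polynomial ℂ)) (MvPolynomial (Fin 6) ℂ ⧸ I) := σ.toAlgebra
  have hΦg (i : Fin 6) : Φ (g i) = φ (X i) := rfl
  have hΦσ (s : Polynomial (Polynomial ℂ)) : Φ (σ s) = j (expandThree ℂ s) := by
    have : Φ.comp σ = j.comp (expandThree ℂ) := by
      ext
      · rename_i c
        have hc : Φ (algebraMap ℂ _ c) = algebraMap ℂ L c := φ.commutes c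
        have hjc : j (Polynomial.C (Polynomial.C c)) = algebraMap ℂ L c :=
          (IsScalarTower.algebraMap_apply ℂ (Polynomial (Polynomial ℂ)) L c).symm
        simp [σ, expandThree, hc, hjc]
      · simp [σ, hΦg, φ, expandThree, a, j]
      · simp [σ, hΦg, φ, expandThree, Y, j]
    exact DFunLike.congr_fun this s
  have rel {p : MvPolynomial (Fin 6) ℂ} (hp : p ∈ I) : Ideal.Quotient.mk I p = 0 :=
    Ideal.Quotient.eq_zero_iff_mem.mpr hp
  have hspan : Submodule.span (Polynomial (Polynomial ℂ)) {1, g 1, g 2, g 4, g 5, g 2 * g 4} =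
      ⊤ := by
    refine span_eq_top_of_minors (k := ℂ) (sx := Polynomial.C Polynomial.X) (sw := Polynomial.X)
      (Q := Q) (q := Ideal.Quotient.mk I Q') ?_ ?_ ?_ ?_ ?_ ?_ ?_ ?_ ?_ ?_ ?_ ?_ ?_ ?_
    · exact fun c => ⟨Polynomial.C (Polynomial.C c), by simp [RingHom.algebraMap_toAlgebra, σ]⟩
    · exact fun b => (Ideal.Quotient.mk_surjective b).imp fun p hp => (hgmk p).trans hp
    · simp [RingHom.algebraMap_toAlgebra, σ]
    · simp [RingHom.algebraMap_toAlgebra, σ]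
    · rw [← hgmk, hQ', aeval_rename]; rfl
    all_goals
      rw [← sub_eq_zero]
      try rw [← sub_sub]
      simp only [g, ← map_mul, ← map_pow, ← map_sub]
      exact rel (hI ▸ Ideal.subset_span (by simp))
  have hrepr (b : MvPolynomial (Fin 6) ℂ ⧸ I) : ∃ s₀ s₁ s₂ s₃ s₄ s₅ : Polynomial (Polynomial ℂ),
      b = σ s₀ + σ s₁ * g 1 + σ s₂ * g 2 + σ s₃ * g 4 + σ s₄ * g 5 + σ s₅ * (g 2 * g 4) := by
    have hb : b ∈ Submodule.span (Polynomial (Polynomial ℂ)) {1, g 1, g 2, g 4, g 5, g 2 * g 4} :=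
      hspan ▸ Submodule.mem_top
    simp only [Submodule.mem_span_insert, Submodule.mem_span_singleton] at hb
    obtain ⟨s₀, _, ⟨s₁, _, ⟨s₂, _, ⟨s₃, _, ⟨s₄, _, ⟨s₅, rfl⟩, rfl⟩, rfl⟩, rfl⟩, rfl⟩, rfl⟩ := hb
    refine ⟨s₀, s₁, s₂, s₃, s₄, s₅, ?_⟩
    simp only [Algebra.smul_def, RingHom.algebraMap_toAlgebra]
    ring
  have hΦ : Function.Injective Φ := by
    refine (injective_iff_map_eq_zero Φ).mpr fun b hb => ?_
    obtain ⟨s₀, s₁, s₂, s₃, s₄, s₅, rfl⟩ := hrepr b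
    simp only [map_add, map_mul, hΦσ, hΦg] at hb
    simp only [φ, aeval_X, Matrix.cons_val] at hb
    obtain ⟨hp, hq⟩ := Polynomial.eq_zero_of_add_mul_sqrt_eq_zero hj (hF ▸ by decide) ht
      (p := expandThree ℂ s₀ + a ^ 2 * (expandThree ℂ s₁ * Y) + a * (expandThree ℂ s₂ * Y ^ 2))
      (q := a * expandThree ℂ s₃ + expandThree ℂ s₄ * Y + a ^ 2 * (expandThree ℂ s₅ * Y ^ 2))
      (by simp only [map_add, map_mul, map_pow]; linear_combination hb)
    have hX : (Polynomial.X : Polynomial ℂ) ≠ 0 := Polynomial.X_ne_zero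
    obtain ⟨rfl, rfl, rfl⟩ := expandThree_eq_zero_of_add one_ne_zero (pow_ne_zero 2 hX) hX
      (by simpa [a, Y] using hp)
    obtain ⟨rfl, rfl, rfl⟩ := expandThree_eq_zero_of_add hX one_ne_zero (pow_ne_zero 2 hX)
      (by simpa [a, Y] using hq)
    simp
  refine ⟨hΦ.isDomain Φ, ?_⟩
  have : Module.Finite (Polynomial (Polynomial ℂ)) (MvPolynomial (Fin 6) ℂ ⧸ I) :=
    ⟨hspan ▸ Submodule.fg_span (Set.toFinite _)⟩
  have hσ : Function.Injective (algebraMap (Polynomial (Polynomial ℂ))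
      (MvPolynomial (Fin 6) ℂ ⧸ I)) := by
    refine (injective_iff_map_eq_zero _).mpr fun s hs => ?_
    have h0 : expandThree ℂ s = 0 := hj <| by
      rw [← hΦσ, map_zero, show σ s = 0 from hs, map_zero]
    exact (expandThree_eq_zero_of_add (k := ℂ) (s₁ := 0) (s₂ := 0) one_ne_zero one_ne_zero
      one_ne_zero (by simp [h0])).1
  rw [ringKrullDim_eq_of_isIntegral_of_injective hσ]
  simp only [Polynomial.ringKrullDim_of_isNoetherianRing, ringKrullDim_eq_zero_of_field]
  norm_num
end

section
/- Let P₁₃ ∈ ℂ[X,Y] be weighted-homogeneous of degree 13 for the weights deg(X,Y) = (1,2) with Y⁷ + X·P₁₃ squarefree, let P̃₉ ∈ ℂ[x,y,z,w] be weighted-homogeneous of degree 9 for the weights deg(x,y,z,w) = (1,2,3,4) with P̃₉(X², X²Y, X²Y², X²Y³) = X⁵·P₁₃(X,Y), and let I ⊆ ℂ[x,y,z,w,v,u] be the ideal generated by the six 2×2 minors of [[x,y,z,v],[y,z,w,u]] together with v²−z²w−xP̃₉, vu−zw²−yP̃₉, u²−w³−zP̃₉. Grade ℂ[x,y,z,w,v,u]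 by deg(x,y,z,w,v,u) = (1,2,3,4,5,6); then I is homogeneous, and the complex dimension of the degree-d homogeneous component of ℂ[x,y,z,w,v,u]/I equals 1, 1, 2, 3 for d = 0, 1, 2, 3 respectively, and equals ⌊3d/2⌋ − 2 for every d ≥ 4. -/
open MvPolynomial

/-- The defining relations of the semicanonical ring between elements `x, y, z, w, v, u, q` of a
commutative ring. -/
structure SemicanonicalRelations {R : Type*} [CommRing R] (f : Fin 6 → R) (q : R) : Prop where
  xz : f 0 * f 2 = f 1 ^ 2
  xw : f 0 * f 3 = f 1 * f 2
  xu : f 0 * f 5 = f 1 * f 4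
  yw : f 1 * f 3 = f 2 ^ 2
  yu : f 1 * f 5 = f 2 * f 4
  zu : f 2 * f 5 = f 3 * f 4
  vv : f 4 ^ 2 = f 2 ^ 2 * f 3 + f 0 * q
  vu : f 4 * f 5 = f 2 * f 3 ^ 2 + f 1 * q
  uu : f 5 ^ 2 = f 3 ^ 3 + f 2 * q

/-- The six generators `1, y, z, v, u, yu` of the semicanonical ring over `ℂ[x, w]`. -/
def semicanonicalGenerator {R : Type*} [CommRing R] (f : Fin 6 → R) : Fin 6 → R :=
  ![1, f 1, f 2, f 4, f 5, f 1 * f 5]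

/-- The degrees of the generators `1, y, z, v, u, yu`. -/
def semicanonicalDegree : Fin 6 → ℕ := ![0, 2, 3, 5, 6, 8]

/-- The normal form `x ^ a * w ^ b * g`, with `g` the `k`-th generator. -/
def semicanonicalMonomial {R : Type*} [CommRing R] (f : Fin 6 → R) (k : Fin 6) (a b : ℕ) : R :=
  f 0 ^ a * f 3 ^ b * semicanonicalGenerator f k

/-- The span of the normal forms of degree `d`. -/
def semicanonicalSpan {R : Type*} [CommRing R] [Algebra ℂ R] (f : Fin 6 → R) (d : ℕ) :
    Submodule ℂ R :=
  Submodule.span ℂ {p | ∃ k a b, a + 4 * b + semicanonicalDegree k = d ∧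
    p = semicanonicalMonomial f k a b}

lemma map_semicanonicalMonomial {R S : Type*} [CommRing R] [CommRing S] (φ : R →+* S)
    (f : Fin 6 → R) (k : Fin 6) (a b : ℕ) :
    φ (semicanonicalMonomial f k a b) = semicanonicalMonomial (φ ∘ f) k a b := by
  fin_cases k <;> simp [semicanonicalMonomial, semicanonicalGenerator]

/-- If multiplication by each `f i` raises the degree of a family of submodules by `w i`, then
multiplication by a weighted homogeneous polynomial in `f` of degree `e` raises it by `e`. -/
lemma MvPolynomial.IsWeightedHomogeneous.aeval_mul_mem {K A σ : Type*} [CommRing K] [CommRing A]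
    [Algebra K A] {w : σ → ℕ} {f : σ → A} {N : ℕ → Submodule K A}
    (hN : ∀ i d, ∀ n ∈ N d, f i * n ∈ N (d + w i)) {e : ℕ} {p : MvPolynomial σ K}
    (hp : p.IsWeightedHomogeneous w e) {d : ℕ} {n : A} (hn : n ∈ N d) :
    aeval f p * n ∈ N (d + e) := by
  have key : ∀ m : σ →₀ ℕ, ∀ d, ∀ n ∈ N d,
      aeval f (monomial m (1 : K)) * n ∈ N (d + Finsupp.weight w m) := by
    intro m
    induction m using Finsupp.induction_linear with
    | zero => intro d n hn; simpa using hn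
    | add m₁ m₂ h₁ h₂ =>
      intro d n hn
      have h := h₁ _ _ (h₂ _ _ hn)
      rw [← mul_assoc, ← map_mul, monomial_mul, one_mul] at h
      rw [map_add, add_comm (Finsupp.weight w m₁), ← add_assoc]
      exact h
    | single i k =>
      intro d n hn
      rw [← X_pow_eq_monomial, map_pow, aeval_X, Finsupp.weight_single]
      induction k with
      | zero => simpa using hn
      | succ k ih =>
        have h := hN i _ _ ih
        rw [pow_succ', mul_assoc, show d + (k + 1) • w i = d + k • w i + w i by
          simp only [smul_eq_mul]; ring]
        exact h
  rw [p.as_sum, map_sum, Finset.sum_mul]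
  refine Submodule.sum_mem _ fun m hm => ?_
  have hme : Finsupp.weight w m = e := hp (mem_support_iff.mp hm)
  have hc : monomial m (coeff m p) = coeff m p • monomial m (1 : K) := by
    rw [smul_monomial, smul_eq_mul, mul_one]
  rw [hc, map_smul, smul_mul_assoc, ← hme]
  exact Submodule.smul_mem _ _ (key m d n hn)

namespace SemicanonicalRelations

variable {R : Type*} [CommRing R] [Algebra ℂ R] {f : Fin 6 → R} {q : R}

lemma monomial_mem {k : Fin 6} {a b d : ℕ} (h : a + 4 * b + semicanonicalDegree k = d) :
    semicanonicalMonomial f k a b ∈ semicanonicalSpan f d :=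
  Submodule.subset_span ⟨k, a, b, h, rfl⟩

lemma mul_mem_of_monomial {g : R} {d e : ℕ}
    (h : ∀ k a b, a + 4 * b + semicanonicalDegree k = d →
      g * semicanonicalMonomial f k a b ∈ semicanonicalSpan f e)
    {n : R} (hn : n ∈ semicanonicalSpan f d) : g * n ∈ semicanonicalSpan f e := by
  have hle : semicanonicalSpan f d ≤ (semicanonicalSpan f e).comap (LinearMap.mulLeft ℂ g) := by
    refine Submodule.span_le.mpr ?_
    rintro _ ⟨k, a, b, hd, rfl⟩
    exact h k a b hd
  exact hle hn

lemma mem_of_eq_monomial {p : R} {d : ℕ} (k : Fin 6) (a b : ℕ)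
    (h : a + 4 * b + semicanonicalDegree k = d) (hp : p = semicanonicalMonomial f k a b) :
    p ∈ semicanonicalSpan f d :=
  hp ▸ monomial_mem h

lemma mem_of_eq_add {p : R} {d : ℕ} (k l : Fin 6) (a b a' b' : ℕ)
    (hq : ∀ d, ∀ n ∈ semicanonicalSpan f d, q * n ∈ semicanonicalSpan f (d + 9))
    (h : a + 4 * b + semicanonicalDegree k = d)
    (h' : a' + 4 * b' + semicanonicalDegree l + 9 = d)
    (hp : p = semicanonicalMonomial f k a b + q * semicanonicalMonomial f l a' b') :
    p ∈ semicanonicalSpan f d :=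
  hp ▸ add_mem (monomial_mem h) (h' ▸ hq _ _ (monomial_mem rfl))

lemma mul_mem_of_lt_four (hf : SemicanonicalRelations f q) (i : Fin 4) {d : ℕ} {n : R}
    (hn : n ∈ semicanonicalSpan f d) :
    f (Fin.castLE (by norm_num) i) * n ∈
      semicanonicalSpan f (d + (![1, 2, 3, 4] : Fin 4 → ℕ) i) := by
  obtain ⟨xz, xw, xu, yw, yu, zu, -, -, -⟩ := hf
  refine mul_mem_of_monomial (fun k a b hd => ?_) hn
  fin_cases i
  · refine mem_of_eq_monomial k (a + 1) b ?_ ?_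
    · simp; omega
    · simp [semicanonicalMonomial]; ring
  · fin_cases k <;> simp [semicanonicalDegree] at hd ⊢
    · refine mem_of_eq_monomial 1 a b ?_ ?_
      · simp [semicanonicalDegree]; omega
      · simp [semicanonicalMonomial, semicanonicalGenerator]; ring
    · refine mem_of_eq_monomial 2 (a + 1) b ?_ ?_
      · simp [semicanonicalDegree]; omega
      · simp [semicanonicalMonomial, semicanonicalGenerator]
        linear_combination -f 0 ^ a * f 3 ^ b * xz
    · refine mem_of_eq_monomial 0 (a + 1) (b + 1) ?_ ?_
      · simp [semicanonicalDegree]; omega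
      · simp [semicanonicalMonomial, semicanonicalGenerator]
        linear_combination -f 0 ^ a * f 3 ^ b * xw
    · refine mem_of_eq_monomial 4 (a + 1) b ?_ ?_
      · simp [semicanonicalDegree]; omega
      · simp [semicanonicalMonomial, semicanonicalGenerator]
        linear_combination -f 0 ^ a * f 3 ^ b * xu
    · refine mem_of_eq_monomial 5 a b ?_ ?_
      · simp [semicanonicalDegree]; omega
      · simp [semicanonicalMonomial, semicanonicalGenerator]; ring
    · refine mem_of_eq_monomial 3 (a + 1) (b + 1) ?_ ?_
      · simp [semicanonicalDegree]; omega
      · simp [semicanonicalMonomial, semicanonicalGenerator]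
        linear_combination -f 0 ^ a * f 3 ^ b * f 5 * xz + f 0 ^ (a + 1) * f 3 ^ b * zu
  · fin_cases k <;> simp [semicanonicalDegree] at hd ⊢
    · refine mem_of_eq_monomial 2 a b ?_ ?_
      · simp [semicanonicalDegree]; omega
      · simp [semicanonicalMonomial, semicanonicalGenerator]; ring
    · refine mem_of_eq_monomial 0 (a + 1) (b + 1) ?_ ?_
      · simp [semicanonicalDegree]; omega
      · simp [semicanonicalMonomial, semicanonicalGenerator]
        linear_combination -f 0 ^ a * f 3 ^ b * xw
    · refine mem_of_eq_monomial 1 a (b + 1) ?_ ?_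
      · simp [semicanonicalDegree]; omega
      · simp [semicanonicalMonomial, semicanonicalGenerator]
        linear_combination -f 0 ^ a * f 3 ^ b * yw
    · refine mem_of_eq_monomial 5 a b ?_ ?_
      · simp [semicanonicalDegree]; omega
      · simp [semicanonicalMonomial, semicanonicalGenerator]
        linear_combination -f 0 ^ a * f 3 ^ b * yu
    · refine mem_of_eq_monomial 3 a (b + 1) ?_ ?_
      · simp [semicanonicalDegree]; omega
      · simp [semicanonicalMonomial, semicanonicalGenerator]
        linear_combination f 0 ^ a * f 3 ^ b * zu
    · refine mem_of_eq_monomial 4 (a + 1) (b + 1) ?_ ?_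
      · simp [semicanonicalDegree]; omega
      · simp [semicanonicalMonomial, semicanonicalGenerator]
        linear_combination -f 0 ^ a * f 3 ^ b * f 5 * xw
  · refine mem_of_eq_monomial k a (b + 1) ?_ ?_
    · simp; omega
    · simp [semicanonicalMonomial]; ring

lemma v_mul_mem (hf : SemicanonicalRelations f q)
    (hq : ∀ d, ∀ n ∈ semicanonicalSpan f d, q * n ∈ semicanonicalSpan f (d + 9))
    {d : ℕ} {n : R} (hn : n ∈ semicanonicalSpan f d) :
    f 4 * n ∈ semicanonicalSpan f (d + 5) := by
  obtain ⟨xz, xw, xu, yw, yu, zu, vv, vu, uu⟩ := hf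
  refine mul_mem_of_monomial (fun k a b hd => ?_) hn
  fin_cases k <;> simp [semicanonicalDegree] at hd ⊢
  · refine mem_of_eq_monomial 3 a b ?_ ?_
    · simp [semicanonicalDegree]; omega
    · simp [semicanonicalMonomial, semicanonicalGenerator]; ring
  · refine mem_of_eq_monomial 4 (a + 1) b ?_ ?_
    · simp [semicanonicalDegree]; omega
    · simp [semicanonicalMonomial, semicanonicalGenerator]
      linear_combination -f 0 ^ a * f 3 ^ b * xu
  · refine mem_of_eq_monomial 5 a b ?_ ?_
    · simp [semicanonicalDegree]; omega
    · simp [semicanonicalMonomial, semicanonicalGenerator]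
      linear_combination -f 0 ^ a * f 3 ^ b * yu
  · refine mem_of_eq_add 1 0 a (b + 2) (a + 1) b hq ?_ ?_ ?_
    · simp [semicanonicalDegree]; omega
    · simp [semicanonicalDegree]; omega
    · simp [semicanonicalMonomial, semicanonicalGenerator]
      linear_combination f 0 ^ a * f 3 ^ b * vv - f 0 ^ a * f 3 ^ (b + 1) * yw
  · refine mem_of_eq_add 2 1 a (b + 2) a b hq ?_ ?_ ?_
    · simp [semicanonicalDegree]; omega
    · simp [semicanonicalDegree]; omega
    · simp [semicanonicalMonomial, semicanonicalGenerator]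
      linear_combination f 0 ^ a * f 3 ^ b * vu
  · refine mem_of_eq_add 0 2 (a + 1) (b + 3) (a + 1) b hq ?_ ?_ ?_
    · simp [semicanonicalDegree]; omega
    · simp [semicanonicalDegree]; omega
    · simp [semicanonicalMonomial, semicanonicalGenerator]
      linear_combination f 0 ^ a * f 3 ^ b * f 1 * vu - f 0 ^ a * f 3 ^ (b + 2) * xw
        - f 0 ^ a * f 3 ^ b * q * xz

lemma u_mul_mem (hf : SemicanonicalRelations f q)
    (hq : ∀ d, ∀ n ∈ semicanonicalSpan f d, q * n ∈ semicanonicalSpan f (d + 9))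
    {d : ℕ} {n : R} (hn : n ∈ semicanonicalSpan f d) :
    f 5 * n ∈ semicanonicalSpan f (d + 6) := by
  obtain ⟨xz, xw, xu, yw, yu, zu, vv, vu, uu⟩ := hf
  refine mul_mem_of_monomial (fun k a b hd => ?_) hn
  fin_cases k <;> simp [semicanonicalDegree] at hd ⊢
  · refine mem_of_eq_monomial 4 a b ?_ ?_
    · simp [semicanonicalDegree]; omega
    · simp [semicanonicalMonomial, semicanonicalGenerator]; ring
  · refine mem_of_eq_monomial 5 a b ?_ ?_
    · simp [semicanonicalDegree]; omega
    · simp [semicanonicalMonomial, semicanonicalGenerator]; ring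
  · refine mem_of_eq_monomial 3 a (b + 1) ?_ ?_
    · simp [semicanonicalDegree]; omega
    · simp [semicanonicalMonomial, semicanonicalGenerator]
      linear_combination f 0 ^ a * f 3 ^ b * zu
  · refine mem_of_eq_add 2 1 a (b + 2) a b hq ?_ ?_ ?_
    · simp [semicanonicalDegree]; omega
    · simp [semicanonicalDegree]; omega
    · simp [semicanonicalMonomial, semicanonicalGenerator]
      linear_combination f 0 ^ a * f 3 ^ b * vu
  · refine mem_of_eq_add 0 2 a (b + 3) a b hq ?_ ?_ ?_
    · simp [semicanonicalDegree]; omega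
    · simp [semicanonicalDegree]; omega
    · simp [semicanonicalMonomial, semicanonicalGenerator]
      linear_combination f 0 ^ a * f 3 ^ b * uu
  · refine mem_of_eq_add 1 0 a (b + 3) (a + 1) (b + 1) hq ?_ ?_ ?_
    · simp [semicanonicalDegree]; omega
    · simp [semicanonicalDegree]; omega
    · simp [semicanonicalMonomial, semicanonicalGenerator]
      linear_combination f 0 ^ a * f 3 ^ b * f 1 * uu - f 0 ^ a * f 3 ^ b * q * xw

/-- Modulo the relations, a weighted homogeneous polynomial of degree `e` is a combination of
normal forms of degree `e`. -/
lemma aeval_mem {Q : MvPolynomial (Fin 4) ℂ} (hQ : Q.IsWeightedHomogeneous ![1, 2, 3, 4] 9)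
    (hf : SemicanonicalRelations f (aeval (fun i : Fin 4 => f (Fin.castLE (by norm_num) i)) Q))
    {e : ℕ} {p : MvPolynomial (Fin 6) ℂ} (hp : p.IsWeightedHomogeneous ![1, 2, 3, 4, 5, 6] e) :
    aeval f p ∈ semicanonicalSpan f e := by
  have hq : ∀ d, ∀ n ∈ semicanonicalSpan f d,
      aeval (fun i : Fin 4 => f (Fin.castLE (by norm_num) i)) Q * n ∈
        semicanonicalSpan f (d + 9) := fun d n hn =>
    hQ.aeval_mul_mem (fun i d n hn => hf.mul_mem_of_lt_four i hn) hn
  have h1 : (1 : R) ∈ semicanonicalSpan f 0 :=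
    mem_of_eq_monomial 0 0 0 rfl (by simp [semicanonicalMonomial, semicanonicalGenerator])
  have h := hp.aeval_mul_mem (f := f) (N := semicanonicalSpan f) (fun i d n hn => ?_) h1
  · simpa using h
  · fin_cases i
    · exact hf.mul_mem_of_lt_four 0 hn
    · exact hf.mul_mem_of_lt_four 1 hn
    · exact hf.mul_mem_of_lt_four 2 hn
    · exact hf.mul_mem_of_lt_four 3 hn
    · exact hf.v_mul_mem hq hn
    · exact hf.u_mul_mem hq hn

end SemicanonicalRelations

/-- The images of `x, y, z, w, v, u` in the double cover `T ^ 2 = F` of `ℂ[X, Y]`. -/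
noncomputable def doubleCoverPoint (F : MvPolynomial (Fin 2) ℂ) :
    Fin 6 → QuadraticAlgebra (MvPolynomial (Fin 2) ℂ) F 0 :=
  ![⟨X 0 ^ 3, 0⟩, ⟨X 0 ^ 2 * X 1, 0⟩, ⟨X 0 * X 1 ^ 2, 0⟩, ⟨X 1 ^ 3, 0⟩, ⟨0, X 0⟩, ⟨0, X 1⟩]

lemma aeval_doubleCoverPoint (F : MvPolynomial (Fin 2) ℂ) (Q : MvPolynomial (Fin 4) ℂ) :
    aeval (doubleCoverPoint F) (rename (Fin.castLE (by norm_num : 4 ≤ 6)) Q) =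
      algebraMap (MvPolynomial (Fin 2) ℂ) _ (aeval ![(X 0 : MvPolynomial (Fin 2) ℂ) ^ 3,
        X 0 ^ 2 * X 1, X 0 * X 1 ^ 2, X 1 ^ 3] Q) := by
  rw [aeval_rename, ← aeval_algebraMap_apply]
  congr 2
  funext i
  fin_cases i <;> rfl

/-- The exponents of the monomial in `X, Y` occurring in the image of a normal form. -/
noncomputable def normalFormExponent (k : Fin 6) (a b : ℕ) : Fin 2 →₀ ℕ :=
  Finsupp.single 0 (3 * a + (![0, 2, 1, 1, 0, 2] : Fin 6 → ℕ) k) +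
    Finsupp.single 1 (3 * b + (![0, 1, 2, 0, 1, 2] : Fin 6 → ℕ) k)

/-- The index of the image of a normal form in the monomial basis of `ℂ[X, Y] × ℂ[X, Y]`. -/
noncomputable def normalFormIndex (k : Fin 6) (a b : ℕ) : (Fin 2 →₀ ℕ) ⊕ (Fin 2 →₀ ℕ) :=
  if k < 3 then Sum.inl (normalFormExponent k a b) else Sum.inr (normalFormExponent k a b)

/-- The coordinates of an element of a quadratic algebra over `ℂ[X, Y]`. -/
def quadraticCoordinates (F : MvPolynomial (Fin 2) ℂ) :
    QuadraticAlgebra (MvPolynomial (Fin 2) ℂ) F 0 →ₗ[ℂ]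
      MvPolynomial (Fin 2) ℂ × MvPolynomial (Fin 2) ℂ where
  toFun s := (s.re, s.im)
  map_add' _ _ := rfl
  map_smul' _ _ := rfl

lemma quadraticCoordinates_semicanonicalMonomial (F : MvPolynomial (Fin 2) ℂ) (k : Fin 6)
    (a b : ℕ) : quadraticCoordinates F (semicanonicalMonomial (doubleCoverPoint F) k a b) =
      (basisMonomials (Fin 2) ℂ).prod (basisMonomials (Fin 2) ℂ) (normalFormIndex k a b) := by
  have hx : doubleCoverPoint F 0 ^ a * doubleCoverPoint F 3 ^ b =
      QuadraticAlgebra.C (X 0 ^ (3 * a) * X 1 ^ (3 * b)) := by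
    rw [pow_mul, pow_mul, QuadraticAlgebra.C_mul, QuadraticAlgebra.C_pow a,
      QuadraticAlgebra.C_pow b]
    rfl
  have hm : ∀ k, (monomial (normalFormExponent k a b) (1 : ℂ) : MvPolynomial (Fin 2) ℂ) =
      X 0 ^ (3 * a + (![0, 2, 1, 1, 0, 2] : Fin 6 → ℕ) k) *
        X 1 ^ (3 * b + (![0, 1, 2, 0, 1, 2] : Fin 6 → ℕ) k) := fun k => by
    rw [X_pow_eq_monomial, X_pow_eq_monomial, monomial_mul, one_mul, normalFormExponent]
  rw [semicanonicalMonomial, hx]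
  fin_cases k <;>
    simp [quadraticCoordinates, semicanonicalGenerator, doubleCoverPoint, normalFormIndex,
      hm, QuadraticAlgebra.C, Module.Basis.prod_apply] <;> ring

lemma normalFormIndex_injective {k l : Fin 6} {a b a' b' : ℕ}
    (h : normalFormIndex k a b = normalFormIndex l a' b') : k = l ∧ b = b' := by
  have key : ∀ {k l : Fin 6}, normalFormExponent k a b = normalFormExponent l a' b' →
      3 * b + (![0, 1, 2, 0, 1, 2] : Fin 6 → ℕ) k =
        3 * b' + (![0, 1, 2, 0, 1, 2] : Fin 6 → ℕ) l := fun h => by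
    simpa [normalFormExponent] using DFunLike.congr_fun h 1
  unfold normalFormIndex at h
  fin_cases k <;> fin_cases l <;> simp at h ⊢ <;> have h' := key h <;> simp at h' <;> omega

/-- The normal forms of degree `d`. -/
def normalFormFamily {R : Type*} [CommRing R] (f : Fin 6 → R) (d : ℕ)
    (i : Σ k : Fin 6, Fin ((d + 4 - semicanonicalDegree k) / 4)) : R :=
  semicanonicalMonomial f i.1 (d - semicanonicalDegree i.1 - 4 * i.2) i.2

lemma span_range_normalFormFamily {R : Type*} [CommRing R] [Algebra ℂ R] (f : Fin 6 → R) (d : ℕ) :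
    Submodule.span ℂ (Set.range (normalFormFamily f d)) = semicanonicalSpan f d := by
  unfold semicanonicalSpan
  congr 1
  ext p
  constructor
  · rintro ⟨⟨k, b, hb⟩, rfl⟩
    exact ⟨k, _, b, by dsimp only; omega, rfl⟩
  · rintro ⟨k, a, b, hd, rfl⟩
    refine ⟨⟨k, b, by omega⟩, ?_⟩
    simp only [normalFormFamily]
    congr 1
    omega

lemma linearIndependent_normalFormFamily (F : MvPolynomial (Fin 2) ℂ) (d : ℕ) :
    LinearIndependent ℂ (normalFormFamily (doubleCoverPoint F) d) := by
  refine LinearIndependent.of_comp (quadraticCoordinates F) ?_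
  have h := ((basisMonomials (Fin 2) ℂ).prod (basisMonomials (Fin 2) ℂ)).linearIndependent.comp
    (fun i : Σ k : Fin 6, Fin ((d + 4 - semicanonicalDegree k) / 4) =>
      normalFormIndex i.1 (d - semicanonicalDegree i.1 - 4 * i.2) i.2) ?_
  · have hfam : quadraticCoordinates F ∘ normalFormFamily (doubleCoverPoint F) d = _ :=
      funext fun i => quadraticCoordinates_semicanonicalMonomial F i.1 _ _
    rw [hfam]
    exact h
  · rintro ⟨k, b⟩ ⟨l, b'⟩ h
    obtain ⟨rfl, hb⟩ := normalFormIndex_injective h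
    exact Sigma.ext rfl (heq_of_eq (Fin.ext hb))

lemma sum_card_normalForm {d : ℕ} (hd : 4 ≤ d) :
    (d + 4 - 0) / 4 + (d + 4 - 2) / 4 + (d + 4 - 3) / 4 + (d + 4 - 5) / 4 + (d + 4 - 6) / 4 +
      (d + 4 - 8) / 4 = 3 * d / 2 - 2 := by
  obtain ⟨m, r, hr, rfl⟩ : ∃ m r, r < 4 ∧ d = 4 * m + r + 4 :=
    ⟨(d - 4) / 4, (d - 4) % 4, Nat.mod_lt _ (by norm_num), by omega⟩
  have h : ∀ c ≤ 8, (4 * m + r + 4 + 4 - c) / 4 = m + (r + 8 - c) / 4 := fun c hc => by omega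
  have h3 : 3 * (4 * m + r + 4) / 2 = 6 * m + (3 * r + 12) / 2 := by omega
  rw [h 0 (by norm_num), h 2 (by norm_num), h 3 (by norm_num), h 5 (by norm_num),
    h 6 (by norm_num), h 8 (by norm_num), h3]
  interval_cases r <;> norm_num <;> omega

lemma isWeightedHomogeneous_semicanonicalMonomial (k : Fin 6) (a b : ℕ) :
    (semicanonicalMonomial (X : Fin 6 → MvPolynomial (Fin 6) ℂ) k a b).IsWeightedHomogeneous
      ![1, 2, 3, 4, 5, 6] (a + 4 * b + semicanonicalDegree k) := by
  have hX := isWeightedHomogeneous_X ℂ (![1, 2, 3, 4, 5, 6] : Fin 6 → ℕ)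
  have hxw := ((hX 0).pow a).mul ((hX 3).pow b)
  have hg : (semicanonicalGenerator (X : Fin 6 → MvPolynomial (Fin 6) ℂ) k).IsWeightedHomogeneous
      ![1, 2, 3, 4, 5, 6] (semicanonicalDegree k) := by
    fin_cases k
    · exact isWeightedHomogeneous_one ℂ _
    · exact hX 1
    · exact hX 2
    · exact hX 4
    · exact hX 5
    · exact (hX 1).mul (hX 5)
  have hdeg : a + 4 * b = a • (![1, 2, 3, 4, 5, 6] : Fin 6 → ℕ) 0 +
      b • (![1, 2, 3, 4, 5, 6] : Fin 6 → ℕ) 3 := by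
    simp [mul_comm]
  rw [hdeg]
  exact hxw.mul hg

/-- Let `P₁₃ ∈ ℂ[X,Y]` be weighted-homogeneous of degree 13 for weights `(1,2)` with
`Y⁷ + X·P₁₃` squarefree, let `P̃₉ = Q ∈ ℂ[x,y,z,w]` be weighted-homogeneous of degree 9
for weights `(1,2,3,4)` with `Q(X², X²Y, X²Y², X²Y³) = X⁵·P₁₃`, and let
`I ⊆ ℂ[x,y,z,w,v,u]` be the ideal generated by the six 2×2 minors of
`[[x,y,z,v],[y,z,w,u]]` together with `v²−z²w−xQ`, `vu−zw²−yQ`, `u²−w³−zQ`.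
Grading `ℂ[x,y,z,w,v,u]` by `deg(x,y,z,w,v,u) = (1,2,3,4,5,6)`, the ideal `I` is
homogeneous, and the dimension of the degree-`d` part of `ℂ[x,y,z,w,v,u]/I` (realized as
the image of the weighted-homogeneous polynomials of degree `d` in the quotient) is
`1, 1, 2, 3` for `d = 0, 1, 2, 3` and `⌊3d/2⌋ − 2` for `d ≥ 4`. -/
theorem hilbert_function_of_semicanonical_curve_ring
    (P13 : MvPolynomial (Fin 2) ℂ)
    (hP13 : P13.IsWeightedHomogeneous ![1, 2] 13)
    (hsf : Squarefree ((X 1 : MvPolynomial (Fin 2) ℂ) ^ 7 + X 0 * P13))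
    (Q : MvPolynomial (Fin 4) ℂ)
    (hQhom : Q.IsWeightedHomogeneous ![1, 2, 3, 4] 9)
    (hQ : aeval ![(X 0 : MvPolynomial (Fin 2) ℂ) ^ 2, (X 0) ^ 2 * X 1,
        (X 0) ^ 2 * (X 1) ^ 2, (X 0) ^ 2 * (X 1) ^ 3] Q = (X 0) ^ 5 * P13)
    (Q' : MvPolynomial (Fin 6) ℂ) (hQ' : Q' = rename (Fin.castLE (by norm_num)) Q)
    (I : Ideal (MvPolynomial (Fin 6) ℂ))
    (hI : I = Ideal.span ({X 0 * X 2 - (X 1)^2, X 0 * X 3 - X 1 * X 2, X 0 * X 5 - X 1 * X 4,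
        X 1 * X 3 - (X 2)^2, X 1 * X 5 - X 2 * X 4, X 2 * X 5 - X 3 * X 4,
        (X 4)^2 - (X 2)^2 * X 3 - X 0 * Q',
        X 4 * X 5 - X 2 * (X 3)^2 - X 1 * Q',
        (X 5)^2 - (X 3)^3 - X 2 * Q'} : Set (MvPolynomial (Fin 6) ℂ)))
    -- the degree-`d` homogeneous component of the quotient ring `ℂ[x,y,z,w,v,u]/I`:
    (S : ℕ → Submodule ℂ (MvPolynomial (Fin 6) ℂ ⧸ I))
    (hS : ∀ d : ℕ, S d = Submodule.map (Ideal.Quotient.mkₐ ℂ I).toLinearMap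
      (weightedHomogeneousSubmodule ℂ ![1, 2, 3, 4, 5, 6] d)) :
    (∀ p ∈ I, ∀ d : ℕ, weightedHomogeneousComponent ![1, 2, 3, 4, 5, 6] d p ∈ I) ∧
    Module.finrank ℂ (S 0) = 1 ∧ Module.finrank ℂ (S 1) = 1 ∧
    Module.finrank ℂ (S 2) = 2 ∧ Module.finrank ℂ (S 3) = 3 ∧
    ∀ d : ℕ, 4 ≤ d → Module.finrank ℂ (S d) = 3 * d / 2 - 2 := by
  have hX := isWeightedHomogeneous_X ℂ (![1, 2, 3, 4, 5, 6] : Fin 6 → ℕ)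
  have hQ'hom : Q'.IsWeightedHomogeneous ![1, 2, 3, 4, 5, 6] 9 := by
    have h := hQhom.aeval_mul_mem (f := fun i : Fin 4 => X (Fin.castLE (by norm_num) i))
      (N := weightedHomogeneousSubmodule ℂ (![1, 2, 3, 4, 5, 6] : Fin 6 → ℕ))
      (fun i d n hn => ?_) (isWeightedHomogeneous_one ℂ _)
    · rw [mul_one, zero_add] at h
      rw [hQ', rename_eq_aeval]
      exact h
    · rw [add_comm]
      fin_cases i
      · exact (hX 0).mul hn
      · exact (hX 1).mul hn
      · exact (hX 2).mul hn
      · exact (hX 3).mul hn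
  have haeval : ∀ p, aeval (fun i => Ideal.Quotient.mkₐ ℂ I (X i)) p = Ideal.Quotient.mkₐ ℂ I p :=
    fun p => (DFunLike.congr_fun (aeval_unique (Ideal.Quotient.mkₐ ℂ I)) p).symm
  have hrel : SemicanonicalRelations (fun i => Ideal.Quotient.mkₐ ℂ I (X i))
      (aeval (fun i : Fin 4 => Ideal.Quotient.mkₐ ℂ I (X (Fin.castLE (by norm_num) i))) Q) := by
    have hq : aeval (fun i : Fin 4 => Ideal.Quotient.mkₐ ℂ I (X (Fin.castLE (by norm_num) i))) Q =
        Ideal.Quotient.mkₐ ℂ I Q' := by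
      rw [hQ', ← haeval, aeval_rename]
      rfl
    have hmk : ∀ p r, p - r ∈ I → Ideal.Quotient.mkₐ ℂ I p = Ideal.Quotient.mkₐ ℂ I r :=
      fun p r h => Ideal.Quotient.eq.mpr h
    rw [hq]
    constructor <;> simp only [← map_mul, ← map_pow, ← map_add] <;> refine hmk _ _ ?_ <;>
      rw [hI] <;> refine Ideal.subset_span ?_ <;> simp [sub_sub]
  have hgen : ∀ d, S d = semicanonicalSpan (fun i => Ideal.Quotient.mkₐ ℂ I (X i)) d := by
    intro d
    rw [hS d]
    apply le_antisymm
    · rintro _ ⟨p, hp, rfl⟩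
      have h := SemicanonicalRelations.aeval_mem hQhom hrel hp
      rwa [haeval] at h
    · refine Submodule.span_le.mpr ?_
      rintro _ ⟨k, a, b, rfl, rfl⟩
      exact ⟨_, isWeightedHomogeneous_semicanonicalMonomial k a b,
        map_semicanonicalMonomial (Ideal.Quotient.mkₐ ℂ I).toRingHom _ k a b⟩
  obtain ⟨G, hG⟩ : ∃ G, G =
      aeval ![(X 0 : MvPolynomial (Fin 2) ℂ) ^ 3, X 0 ^ 2 * X 1, X 0 * X 1 ^ 2, X 1 ^ 3] Q :=
    ⟨_, rfl⟩
  obtain ⟨F, hF⟩ : ∃ F : MvPolynomial (Fin 2) ℂ, F = X 1 ^ 7 + X 0 * G := ⟨_, rfl⟩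
  have hker : ∀ p ∈ I, aeval (doubleCoverPoint F) p = 0 := by
    intro p hp
    have hle : I ≤ RingHom.ker (aeval (R := ℂ) (doubleCoverPoint F)) := by
      rw [hI, Ideal.span_le]
      have hQF := aeval_doubleCoverPoint F Q
      rw [← hQ', ← hG] at hQF
      simp only [Set.insert_subset_iff, Set.singleton_subset_iff, SetLike.mem_coe,
        RingHom.mem_ker, map_sub, map_mul, map_pow, aeval_X, hQF]
      refine ⟨?_, ?_, ?_, ?_, ?_, ?_, ?_, ?_, ?_⟩ <;>
        ext1 <;> simp [doubleCoverPoint, pow_succ, QuadraticAlgebra.algebraMap_eq] <;>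
        first | done | ring1 | (rw [hF]; ring1)
    exact hle hp
  have hli : ∀ d, LinearIndependent ℂ
      (normalFormFamily (fun i => Ideal.Quotient.mkₐ ℂ I (X i)) d) := by
    intro d
    refine LinearIndependent.of_comp
      (Ideal.Quotient.liftₐ I (aeval (doubleCoverPoint F)) hker).toLinearMap ?_
    have hfam : (Ideal.Quotient.liftₐ I (aeval (doubleCoverPoint F)) hker).toLinearMap ∘
        normalFormFamily (fun i => Ideal.Quotient.mkₐ ℂ I (X i)) d =
          normalFormFamily (doubleCoverPoint F) d := by
      funext i
      refine (map_semicanonicalMonomial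
        (Ideal.Quotient.liftₐ I (aeval (doubleCoverPoint F)) hker).toRingHom _ _ _ _).trans ?_
      unfold normalFormFamily
      congr 1
      funext j
      exact aeval_X _ _
    rw [hfam]
    exact linearIndependent_normalFormFamily F d
  have hrank : ∀ d, Module.finrank ℂ (S d) =
      ∑ k : Fin 6, (d + 4 - semicanonicalDegree k) / 4 := by
    intro d
    rw [hgen, ← span_range_normalFormFamily, finrank_span_eq_card (hli d)]
    simp
  simp only [hrank, Fin.sum_univ_six, semicanonicalDegree]
  refine ⟨?_, rfl, rfl, rfl, rfl, fun d hd => ?_⟩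
  · let _ := weightedGradedAlgebra ℂ (![1, 2, 3, 4, 5, 6] : Fin 6 → ℕ)
    have hhom : I.IsHomogeneous (weightedHomogeneousSubmodule ℂ ![1, 2, 3, 4, 5, 6]) := by
      rw [hI]
      refine Ideal.homogeneous_span _ _ ?_
      simp only [Set.forall_mem_insert, Set.mem_singleton_iff, forall_eq]
      refine ⟨⟨4, ?_⟩, ⟨5, ?_⟩, ⟨7, ?_⟩, ⟨6, ?_⟩, ⟨8, ?_⟩, ⟨9, ?_⟩, ⟨10, ?_⟩, ⟨11, ?_⟩, ⟨12, ?_⟩⟩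
      · exact ((hX 0).mul (hX 2)).sub ((hX 1).pow 2)
      · exact ((hX 0).mul (hX 3)).sub ((hX 1).mul (hX 2))
      · exact ((hX 0).mul (hX 5)).sub ((hX 1).mul (hX 4))
      · exact ((hX 1).mul (hX 3)).sub ((hX 2).pow 2)
      · exact ((hX 1).mul (hX 5)).sub ((hX 2).mul (hX 4))
      · exact ((hX 2).mul (hX 5)).sub ((hX 3).mul (hX 4))
      · exact (((hX 4).pow 2).sub (((hX 2).pow 2).mul (hX 3))).sub ((hX 0).mul hQ'hom)
      · exact (((hX 4).mul (hX 5)).sub ((hX 2).mul ((hX 3).pow 2))).sub ((hX 1).mul hQ'hom)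
      · exact (((hX 5).pow 2).sub ((hX 3).pow 3)).sub ((hX 2).mul hQ'hom)
    exact fun p hp d => weightedHomogeneousComponent_mem_of_mem ℂ _ hhom hp d
  · exact sum_card_normalForm hd
end
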